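/- Let A be a commutative noetherian ring with dim A ≤ 3, 𝔞 an ideal, x = x_1,…,x_t ∈ A, and M an 𝔞-cofinite A-module. Then Hom_A(A/𝔞, H^i(x,M)) is finitely generated for all i ≤ n+1 if and only if H^i(x,M) is 𝔞-cofinite for all i ≤ n. -/

import Mathlib

open CategoryTheory Limits

noncomputable section

variable {A : Type} [CommRing A]

/-- The `i`-th term of the Koszul cochain complex `Hom_A(K_•(x), M)`. -/
abbrev KoszulCochain {t : ℕ} (x : Fin t → A) (M : Type) [AddCommGroup M] [Module A M]
    (i : ℕ) : Type :=
  {s : Finset (Fin t) // s.card = i} → M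

/-- The Koszul cochain differential. -/
def koszulD {t : ℕ} (x : Fin t → A) (M : Type) [AddCommGroup M] [Module A M] (i : ℕ) :
    KoszulCochain x M i →ₗ[A] KoszulCochain x M (i + 1) :=
  LinearMap.pi fun s => ∑ j ∈ s.1.attach,
    (((-1 : A) ^ ((s.1.filter (fun k => k < j.1)).card)) * x j.1) •
      (LinearMap.proj
        (⟨s.1.erase j.1, by simp [Finset.card_erase_of_mem j.2, s.2]⟩ :
          {s : Finset (Fin t) // s.card = i}) :
        KoszulCochain x M i →ₗ[A] M)

/-- The boundaries in degree `i` of the Koszul cochain complex. -/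
def koszulBoundary {t : ℕ} (x : Fin t → A) (M : Type) [AddCommGroup M] [Module A M] :
    (i : ℕ) → Submodule A (KoszulCochain x M i)
  | 0 => ⊥
  | j + 1 => LinearMap.range (koszulD x M j)

/-- The `i`-th Koszul cohomology `H^i(x, M)` of `M` with respect to `x`. -/
abbrev KoszulCohomology {t : ℕ} (x : Fin t → A) (M : Type) [AddCommGroup M] [Module A M]
    (i : ℕ) : Type :=
  LinearMap.ker (koszulD x M i) ⧸
    (koszulBoundary x M i).comap (LinearMap.ker (koszulD x M i)).subtype

/-- `Ext_A^i(A/𝔞, M)` as an `A`-module. -/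
abbrev extQuot (𝔞 : Ideal A) (M : Type) [AddCommGroup M] [Module A M] (i : ℕ) : Type :=
  ↥(((_root_.Ext A (ModuleCat A) i).obj
    (Opposite.op (ModuleCat.of A (A ⧸ 𝔞)))).obj (ModuleCat.of A M))

/-- `M` is an `𝔞`-cofinite `A`-module: `Supp M ⊆ V(𝔞)` and all `Ext_A^i(A/𝔞, M)`
are finitely generated. -/
def IsCofinite (𝔞 : Ideal A) (M : Type) [AddCommGroup M] [Module A M] : Prop :=
  Module.support A M ⊆ PrimeSpectrum.zeroLocus (𝔞 : Set A) ∧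
    ∀ i : ℕ, Module.Finite A (extQuot 𝔞 M i)

section
namespace KC
open CategoryTheory.Abelian

/-- finiteness of the derived-category `Ext`. -/
def FinE (i : ℕ) (L N : Type) [AddCommGroup L] [Module A L] [AddCommGroup N] [Module A N] : Prop :=
  Module.Finite A (Abelian.Ext (ModuleCat.of A L) (ModuleCat.of A N) i)

lemma extMk_smul {X Y : ModuleCat.{0} A} (R : ProjectiveResolution X) (n : ℕ)
    (f : R.complex.X n ⟶ Y) (hf : R.complex.d (n+1) n ≫ f = 0) (r : A) :
    R.extMk (r • f) (n+1) rfl (by simp [hf]) = r • R.extMk f (n+1) rfl hf := by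
  rw [Ext.smul_eq_comp_mk₀, R.extMk_comp_mk₀]
  congr 1

lemma extMk_eq_zero_iff' {X Y : ModuleCat.{0} A} (R : ProjectiveResolution X) (n : ℕ)
    (f : R.complex.X n ⟶ Y) (hf : R.complex.d (n+1) n ≫ f = 0) :
    R.extMk f (n+1) rfl hf = 0 ↔ ∃ g : R.complex.X ((ComplexShape.up ℕ).prev n) ⟶ Y,
      R.complex.d n ((ComplexShape.up ℕ).prev n) ≫ g = f := by
  cases n with
  | succ p =>
    have := R.extMk_eq_zero_iff f (p+1+1) rfl hf p rfl
    rw [this]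
    have h : (ComplexShape.up ℕ).prev (p+1) = p := CochainComplex.prev_nat_succ p
    rw [h]
  | zero =>
    simp only [← R.extEquivCohomologyClass.apply_eq_iff_eq,
      R.extEquivCohomologyClass_extMk, R.extEquivCohomologyClass_zero,
      CochainComplex.HomComplex.CohomologyClass.mk_eq_zero_iff]
    rw [CochainComplex.HomComplex.Cocycle.toSingleMk_mem_coboundaries_iff _ _ _ _ _ 1 (by simp)]
    have hz : IsZero (R.cochainComplex.X 1) := CochainComplex.isZero_of_isStrictlyLE _ 0 _
    constructor
    · rintro ⟨g, hg⟩
      refine ⟨0, ?_⟩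
      obtain rfl : g = 0 := hz.eq_of_src _ _
      rw [← cancel_epi (R.cochainComplexXIso (-((0:ℕ):ℤ)) 0 rfl).hom]
      simpa using hg
    · rintro ⟨g, hg⟩
      refine ⟨0, ?_⟩
      rw [← hg, R.complex.shape _ _ (by simp)]
      simp

lemma finE_iff (𝔞 : Ideal A) (M : Type) [AddCommGroup M] [Module A M] (i : ℕ) :
    Module.Finite A (extQuot 𝔞 M i) ↔ FinE (A := A) i (A ⧸ 𝔞) M := by
  let X := ModuleCat.of A (A ⧸ 𝔞)
  let Y := ModuleCat.of A M
  let R : ProjectiveResolution X := projectiveResolution X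
  let S := (R.complex.linearYonedaObj A Y).sc i
  have e1 : extQuot 𝔞 M i ≃ₗ[A] (LinearMap.ker S.g.hom ⧸ LinearMap.range S.moduleCatToCycles) :=
    ((R.isoExt (R := A) i Y) ≪≫ S.moduleCatHomologyIso).toLinearEquiv
  have hd : ∀ (j k : ℕ) (f : R.complex.X j ⟶ Y),
      ((R.complex.linearYonedaObj A Y).d j k).hom f = R.complex.d k j ≫ f := fun j k f => rfl
  have hn : (ComplexShape.up ℕ).next i = i + 1 := CochainComplex.next ℕ i
  have hg : ∀ f : R.complex.X i ⟶ Y, S.g.hom f = 0 ↔ R.complex.d (i+1) i ≫ f = 0 := by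
    intro f
    change R.complex.d ((ComplexShape.up ℕ).next i) i ≫ f = 0 ↔ _
    rw [hn]
  let φ : LinearMap.ker S.g.hom →ₗ[A] Abelian.Ext X Y i :=
    { toFun := fun f => R.extMk (f.1 : R.complex.X i ⟶ Y) (i+1) rfl ((hg _).1 f.2)
      map_add' := fun f g => (R.add_extMk _ _ _ _ _ _).symm
      map_smul' := fun r f => extMk_smul R i _ ((hg _).1 f.2) r }
  have hsurj : Function.Surjective φ := by
    intro α
    obtain ⟨f, hf, rfl⟩ := R.extMk_surjective α (i+1) rfl
    exact ⟨⟨f, (hg f).2 hf⟩, rfl⟩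
  have hker : LinearMap.ker φ = LinearMap.range S.moduleCatToCycles := by
    ext f
    rw [LinearMap.mem_ker]
    refine (extMk_eq_zero_iff' R i _ ((hg _).1 f.2)).trans ?_
    constructor
    · rintro ⟨g, h⟩
      exact ⟨g, Subtype.ext h⟩
    · rintro ⟨g, h⟩
      exact ⟨g, congrArg Subtype.val h⟩
  let e2 := (Submodule.quotEquivOfEq _ _ hker.symm).trans (φ.quotKerEquivOfSurjective hsurj)
  exact ⟨fun h => Module.Finite.equiv (e1.trans e2), fun h => by
    have : Module.Finite A (Abelian.Ext X Y i) := h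
    exact Module.Finite.equiv (e1.trans e2).symm⟩
end KC
end

section
namespace KC
open CategoryTheory.Abelian

lemma fin_mid [IsNoetherianRing A] {X Y Z : Type*} [AddCommGroup X] [Module A X] [AddCommGroup Y]
    [Module A Y] [AddCommGroup Z] [Module A Z] (f : X →ₗ[A] Y) (g : Y →ₗ[A] Z)
    (h : ∀ y, g y = 0 → ∃ x, f x = y) (hX : Module.Finite A X) (hZ : Module.Finite A Z) :
    Module.Finite A Y := by
  refine ⟨Submodule.fg_of_fg_map_of_fg_inf_ker g ?_ ?_⟩
  · exact IsNoetherian.noetherian _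
  · rw [top_inf_eq]
    have : (LinearMap.ker g) ≤ LinearMap.range f := fun y hy => h y hy
    have hr : Module.Finite A (LinearMap.range f) := Module.Finite.range f
    exact Submodule.FG.of_le (Module.Finite.iff_fg.1 hr) this

section
variable {L N₁ N₂ N₃ : Type} [AddCommGroup L] [Module A L] [AddCommGroup N₁] [Module A N₁]
  [AddCommGroup N₂] [Module A N₂] [AddCommGroup N₃] [Module A N₃]

/-- the map on Ext induced by a map in the second variable -/
def post (L : Type) [AddCommGroup L] [Module A L] (f : N₁ →ₗ[A] N₂) (i : ℕ) :
    Abelian.Ext (ModuleCat.of A L) (ModuleCat.of A N₁) i →ₗ[A]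
      Abelian.Ext (ModuleCat.of A L) (ModuleCat.of A N₂) i :=
  (Ext.bilinearCompOfLinear A _ _ _ i 0 i (add_zero i)).flip (Ext.mk₀ (ModuleCat.ofHom f))

def pre (L : Type) [AddCommGroup L] [Module A L] (f : N₁ →ₗ[A] N₂) (i : ℕ) :
    Abelian.Ext (ModuleCat.of A N₂) (ModuleCat.of A L) i →ₗ[A]
      Abelian.Ext (ModuleCat.of A N₁) (ModuleCat.of A L) i :=
  (Ext.bilinearCompOfLinear A _ _ _ 0 i i (zero_add i)) (Ext.mk₀ (ModuleCat.ofHom f))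

lemma post_apply (f : N₁ →ₗ[A] N₂) (i : ℕ)
    (x : Abelian.Ext (ModuleCat.of A L) (ModuleCat.of A N₁) i) :
    post L f i x = x.comp (Ext.mk₀ (ModuleCat.ofHom f)) (add_zero i) := rfl

lemma pre_apply (f : N₁ →ₗ[A] N₂) (i : ℕ)
    (x : Abelian.Ext (ModuleCat.of A N₂) (ModuleCat.of A L) i) :
    pre L f i x = (Ext.mk₀ (ModuleCat.ofHom f)).comp x (zero_add i) := rfl

lemma post_comp (f : N₁ →ₗ[A] N₂) (g : N₂ →ₗ[A] N₃) (i : ℕ)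
    (x : Abelian.Ext (ModuleCat.of A L) (ModuleCat.of A N₁) i) :
    post L g i (post L f i x) = post L (g ∘ₗ f) i x := by
  simp [post_apply, ModuleCat.ofHom_comp]

lemma pre_comp (f : N₁ →ₗ[A] N₂) (g : N₂ →ₗ[A] N₃) (i : ℕ)
    (x : Abelian.Ext (ModuleCat.of A N₃) (ModuleCat.of A L) i) :
    pre L f i (pre L g i x) = pre L (g ∘ₗ f) i x := by
  simp [pre_apply, ModuleCat.ofHom_comp]

lemma post_smul (i : ℕ) (r : A) (x : Abelian.Ext (ModuleCat.of A L) (ModuleCat.of A N₁) i) :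
    post L (r • (LinearMap.id : N₁ →ₗ[A] N₁)) i x = r • x := by
  rw [post_apply, Ext.smul_eq_comp_mk₀]; rfl

lemma pre_smul (i : ℕ) (r : A) (x : Abelian.Ext (ModuleCat.of A N₁) (ModuleCat.of A L) i) :
    pre L (r • (LinearMap.id : N₁ →ₗ[A] N₁)) i x = r • x := by
  rw [pre_apply]
  have : ModuleCat.ofHom (r • (LinearMap.id : N₁ →ₗ[A] N₁)) = r • 𝟙 _ := rfl
  rw [this, Ext.mk₀_smul, Ext.smul_comp]; simp

lemma FinE.congr_right {i : ℕ} (e : N₁ ≃ₗ[A] N₂) (h : FinE (A := A) i L N₁) :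
    FinE (A := A) i L N₂ := by
  have : Module.Finite A _ := h
  refine Module.Finite.of_surjective (post L e.toLinearMap i) fun x =>
    ⟨post L e.symm.toLinearMap i x, ?_⟩
  rw [post_comp]
  have := post_smul (L := L) i 1 x
  simpa using this

lemma FinE.congr_left {i : ℕ} (e : N₁ ≃ₗ[A] N₂) (h : FinE (A := A) i N₁ L) :
    FinE (A := A) i N₂ L := by
  have : Module.Finite A _ := h
  refine Module.Finite.of_surjective (pre L e.symm.toLinearMap i) fun x =>
    ⟨pre L e.toLinearMap i x, ?_⟩
  rw [pre_comp]
  have := pre_smul (L := L) i 1 x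
  simpa using this

/-- short exact sequence of modules -/
structure SES (f : N₁ →ₗ[A] N₂) (g : N₂ →ₗ[A] N₃) : Prop where
  inj : Function.Injective f
  surj : Function.Surjective g
  exact : Function.Exact f g

def SES.cx {f : N₁ →ₗ[A] N₂} {g : N₂ →ₗ[A] N₃} (h : SES f g) : ShortComplex (ModuleCat A) :=
  ShortComplex.mk (ModuleCat.ofHom f) (ModuleCat.ofHom g) (by
    ext x; exact h.exact.apply_apply_eq_zero x)

lemma SES.shortExact {f : N₁ →ₗ[A] N₂} {g : N₂ →ₗ[A] N₃} (h : SES f g) : h.cx.ShortExact := by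
  have : Mono h.cx.f := (ModuleCat.mono_iff_injective _).2 h.inj
  have : Epi h.cx.g := (ModuleCat.epi_iff_surjective _).2 h.surj
  refine ⟨?_⟩
  rw [ShortComplex.moduleCat_exact_iff]
  intro x hx
  exact (h.exact x).1 hx

variable {f : N₁ →ₗ[A] N₂} {g : N₂ →ₗ[A] N₃}

lemma SES.post_exact (h : SES f g) (i : ℕ)
    (x : Abelian.Ext (ModuleCat.of A L) (ModuleCat.of A N₂) i) (hx : post L g i x = 0) :
    ∃ y, post L f i y = x :=
  Ext.covariant_sequence_exact₂ _ h.shortExact x hx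

lemma SES.pre_exact (h : SES f g) (i : ℕ)
    (x : Abelian.Ext (ModuleCat.of A N₂) (ModuleCat.of A L) i) (hx : pre L f i x = 0) :
    ∃ y, pre L g i y = x :=
  Ext.contravariant_sequence_exact₂ h.shortExact _ x hx

def SES.δ (h : SES f g) (L : Type) [AddCommGroup L] [Module A L] (i : ℕ) :
    Abelian.Ext (ModuleCat.of A L) (ModuleCat.of A N₃) i →ₗ[A]
      Abelian.Ext (ModuleCat.of A L) (ModuleCat.of A N₁) (i+1) :=
  (Ext.bilinearCompOfLinear A _ _ _ i 1 (i+1) rfl).flip h.shortExact.extClass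

def SES.δ' (h : SES f g) (L : Type) [AddCommGroup L] [Module A L] (i : ℕ) :
    Abelian.Ext (ModuleCat.of A N₁) (ModuleCat.of A L) i →ₗ[A]
      Abelian.Ext (ModuleCat.of A N₃) (ModuleCat.of A L) (i+1) :=
  (Ext.bilinearCompOfLinear A _ _ _ 1 i (i+1) (add_comm 1 i)) h.shortExact.extClass

lemma SES.δ_exact (h : SES f g) (i : ℕ)
    (x : Abelian.Ext (ModuleCat.of A L) (ModuleCat.of A N₁) (i+1)) (hx : post L f (i+1) x = 0) :
    ∃ y, h.δ L i y = x :=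
  Ext.covariant_sequence_exact₁ _ h.shortExact x hx rfl

lemma SES.exact_δ (h : SES f g) (i : ℕ)
    (x : Abelian.Ext (ModuleCat.of A L) (ModuleCat.of A N₃) i) (hx : h.δ L i x = 0) :
    ∃ y, post L g i y = x :=
  Ext.covariant_sequence_exact₃ _ h.shortExact x rfl hx

lemma SES.δ'_exact (h : SES f g) (i : ℕ)
    (x : Abelian.Ext (ModuleCat.of A N₃) (ModuleCat.of A L) (i+1)) (hx : pre L g (i+1) x = 0) :
    ∃ y, h.δ' L i y = x :=
  Ext.contravariant_sequence_exact₃ h.shortExact _ x hx (add_comm 1 i)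

lemma SES.exact_δ' (h : SES f g) (i : ℕ)
    (x : Abelian.Ext (ModuleCat.of A N₁) (ModuleCat.of A L) i) (hx : h.δ' L i x = 0) :
    ∃ y, pre L f i y = x :=
  Ext.contravariant_sequence_exact₁ h.shortExact _ x (add_comm 1 i) hx

lemma post_inj (hf : Function.Injective f) : Function.Injective (post L f 0) := by
  have : Mono (ModuleCat.ofHom f) := (ModuleCat.mono_iff_injective _).2 hf
  exact Ext.postcomp_mk₀_injective_of_mono (ModuleCat.of A L) (ModuleCat.ofHom f)

lemma pre_inj (hg : Function.Surjective g) : Function.Injective (pre L g 0) := by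
  have : Epi (ModuleCat.ofHom g) := (ModuleCat.epi_iff_surjective _).2 hg
  exact Ext.precomp_mk₀_injective_of_epi (ModuleCat.of A L) (ModuleCat.ofHom g)

variable [IsNoetherianRing A]

lemma SES.cov_mid (h : SES f g) {i : ℕ} (h1 : FinE (A := A) i L N₁) (h3 : FinE (A := A) i L N₃) :
    FinE (A := A) i L N₂ := fin_mid _ _ (h.post_exact i) h1 h3

lemma SES.cov_right (h : SES f g) {i : ℕ} (h2 : FinE (A := A) i L N₂)
    (h1 : FinE (A := A) (i+1) L N₁) : FinE (A := A) i L N₃ := fin_mid _ _ (h.exact_δ i) h2 h1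

lemma SES.cov_left (h : SES f g) {i : ℕ} (h2 : FinE (A := A) (i+1) L N₂)
    (h3 : FinE (A := A) i L N₃) : FinE (A := A) (i+1) L N₁ := fin_mid _ _ (h.δ_exact i) h3 h2

lemma FinE.of_inj (hf : Function.Injective f) (h2 : FinE (A := A) 0 L N₂) :
    FinE (A := A) 0 L N₁ := by
  have : Module.Finite A _ := h2
  exact Module.Finite.of_injective _ (post_inj hf)

lemma SES.con_mid (h : SES f g) {i : ℕ} (h1 : FinE (A := A) i N₁ L) (h3 : FinE (A := A) i N₃ L) :
    FinE (A := A) i N₂ L := fin_mid _ _ (h.pre_exact i) h3 h1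

lemma SES.con_left (h : SES f g) {i : ℕ} (h2 : FinE (A := A) i N₂ L)
    (h3 : FinE (A := A) (i+1) N₃ L) : FinE (A := A) i N₁ L := fin_mid _ _ (h.exact_δ' i) h2 h3

lemma SES.con_right (h : SES f g) {i : ℕ} (h2 : FinE (A := A) (i+1) N₂ L)
    (h1 : FinE (A := A) i N₁ L) : FinE (A := A) (i+1) N₃ L := fin_mid _ _ (h.δ'_exact i) h1 h2

lemma FinE.of_surj (hg : Function.Surjective g) (h2 : FinE (A := A) 0 N₂ L) :
    FinE (A := A) 0 N₃ L := by
  have : Module.Finite A _ := h2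
  exact Module.Finite.of_injective _ (pre_inj hg)

end

section
variable {L N : Type} [AddCommGroup L] [Module A L] [AddCommGroup N] [Module A N]

lemma finE_zero_iff : FinE (A := A) 0 L N ↔ Module.Finite A (L →ₗ[A] N) := by
  let e : Abelian.Ext (ModuleCat.of A L) (ModuleCat.of A N) 0 ≃ₗ[A] (L →ₗ[A] N) :=
    (Ext.linearEquiv₀ (R := A)).trans (ModuleCat.homLinearEquiv (S := A))
  exact ⟨fun h => by have : Module.Finite A _ := h; exact Module.Finite.equiv e,
    fun h => Module.Finite.equiv e.symm⟩

lemma FinE.of_free_succ [Module.Projective A L] (i : ℕ) : FinE (A := A) (i+1) L N := by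
  have : Projective (ModuleCat.of A L) := (IsProjective.iff_projective _ ).1 inferInstance
  have : Subsingleton (Abelian.Ext (ModuleCat.of A L) (ModuleCat.of A N) (i+1)) :=
    subsingleton_of_forall_eq 0 Ext.eq_zero_of_projective
  unfold FinE
  infer_instance

lemma FinE.of_subsingleton_right [Subsingleton N] (i : ℕ) : FinE (A := A) i L N := by
  have : Subsingleton (Abelian.Ext (ModuleCat.of A L) (ModuleCat.of A N) i) := by
    refine subsingleton_of_forall_eq 0 fun x => ?_
    have h := post_smul (L := L) (N₁ := N) i 1 x
    have h0 := post_smul (L := L) (N₁ := N) i 0 x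
    have hh : (1 : A) • (LinearMap.id : N →ₗ[A] N) = (0 : A) • LinearMap.id := by
      ext; exact Subsingleton.elim _ _
    rw [hh, h0] at h
    simpa using h.symm
  unfold FinE
  infer_instance

lemma FinE.of_subsingleton_left [Subsingleton L] (i : ℕ) : FinE (A := A) i L N := by
  have : Subsingleton (Abelian.Ext (ModuleCat.of A L) (ModuleCat.of A N) i) := by
    refine subsingleton_of_forall_eq 0 fun x => ?_
    have h := pre_smul (L := N) (N₁ := L) i 1 x
    have h0 := pre_smul (L := N) (N₁ := L) i 0 x
    have hh : (1 : A) • (LinearMap.id : L →ₗ[A] L) = (0 : A) • LinearMap.id := by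
      ext; exact Subsingleton.elim _ _
    rw [hh, h0] at h
    simpa using h.symm
  unfold FinE
  infer_instance
end

lemma ses_mk {N : Type} [AddCommGroup N] [Module A N] (K : Submodule A N) :
    SES K.subtype K.mkQ :=
  ⟨K.injective_subtype, K.mkQ_surjective, LinearMap.exact_subtype_mkQ K⟩

lemma ses_ker {N N' : Type} [AddCommGroup N] [Module A N] [AddCommGroup N'] [Module A N']
    (f : N →ₗ[A] N') : SES (LinearMap.ker f).subtype f.rangeRestrict :=
  ⟨Submodule.injective_subtype _, f.surjective_rangeRestrict, by
    intro x
    simp [Subtype.ext_iff]⟩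

lemma ses_option (α : Type) (M : Type) [AddCommGroup M] [Module A M] :
    SES (A := A) (N₁ := M) (N₂ := Option α → M) (N₃ := α → M)
      (LinearMap.pi fun o => o.elim LinearMap.id (fun _ => 0))
      (LinearMap.funLeft A M some) := by
  refine ⟨?_, ?_, ?_⟩
  · intro x y h
    simpa using congrFun h none
  · intro f
    refine ⟨fun o => o.elim 0 f, ?_⟩
    ext i; simp [LinearMap.funLeft_apply]
  · intro f
    constructor
    · intro h
      refine ⟨f none, ?_⟩
      ext o
      cases o with
      | none => simp
      | some a => simpa [LinearMap.funLeft_apply] using (congrFun h a).symm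
    · rintro ⟨m, rfl⟩
      ext a
      simp [LinearMap.funLeft_apply]

lemma FinE.pi_right [IsNoetherianRing A] {L M : Type} [AddCommGroup L] [Module A L]
    [AddCommGroup M] [Module A M] {i : ℕ} (h : FinE (A := A) i L M) (ι : Type) [Finite ι] :
    FinE (A := A) i L (ι → M) := by
  induction ι using Finite.induction_empty_option with
  | of_equiv e ih => exact ih.congr_right (LinearEquiv.funCongrLeft A M e.symm)
  | h_empty => exact FinE.of_subsingleton_right i
  | h_option ih => exact (ses_option (A := A) _ M).cov_mid h ih

lemma FinE.pi_left [IsNoetherianRing A] {L M : Type} [AddCommGroup L] [Module A L]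
    [AddCommGroup M] [Module A M] {i : ℕ} (h : FinE (A := A) i M L) (ι : Type) [Finite ι] :
    FinE (A := A) i (ι → M) L := by
  induction ι using Finite.induction_empty_option with
  | of_equiv e ih => exact ih.congr_left (LinearEquiv.funCongrLeft A M e.symm)
  | h_empty => exact FinE.of_subsingleton_left i
  | h_option ih => exact (ses_option (A := A) _ M).con_mid h ih

end KC
end

section
namespace KC
open CategoryTheory.Abelian

/-- `L` is killed by the ideal `a` -/
def Killed (a : Ideal A) (L : Type) [AddCommGroup L] [Module A L] : Prop :=
  ∀ x ∈ a, ∀ l : L, x • l = 0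

lemma Killed.mono {a b : Ideal A} {L : Type} [AddCommGroup L] [Module A L] (h : Killed b L)
    (hab : a ≤ b) : Killed a L := fun x hx l => h x (hab hx) l

lemma Killed.sub {a : Ideal A} {L : Type} [AddCommGroup L] [Module A L] (h : Killed a L)
    (K : Submodule A L) : Killed a K := fun x hx l => Subtype.ext (h x hx l)

lemma Killed.quot {a : Ideal A} {L : Type} [AddCommGroup L] [Module A L] (h : Killed a L)
    (K : Submodule A L) : Killed a (L ⧸ K) := fun x hx l => by
  obtain ⟨l, rfl⟩ := K.mkQ_surjective l
  rw [← map_smul, h x hx, map_zero]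

lemma killed_quot (a : Ideal A) : Killed a (A ⧸ a) := fun x hx l => by
  obtain ⟨l, rfl⟩ := Ideal.Quotient.mk_surjective l
  exact Ideal.Quotient.eq_zero_iff_mem.2 (a.mul_mem_right l hx)

lemma Killed.pi {a : Ideal A} {L : Type} [AddCommGroup L] [Module A L] (h : Killed a L)
    (ι : Type) : Killed a (ι → L) := fun x hx l => by
  ext i; exact h x hx (l i)

lemma exists_surj {b : Ideal A} {L : Type} [AddCommGroup L] [Module A L] [hL : Module.Finite A L]
    (h : Killed b L) : ∃ (m : ℕ) (f : (Fin m → A ⧸ b) →ₗ[A] L), Function.Surjective f := by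
  obtain ⟨m, v, hv⟩ := Module.Finite.exists_fin (R := A) (M := L)
  let g : Fin m → ((A ⧸ b) →ₗ[A] L) := fun i =>
    Submodule.liftQ b (LinearMap.toSpanSingleton A L (v i)) (fun x hx => h x hx (v i))
  let f : (Fin m → A ⧸ b) →ₗ[A] L := ∑ i, (g i).comp (LinearMap.proj i)
  refine ⟨m, f, ?_⟩
  rw [← LinearMap.range_eq_top, eq_top_iff, ← hv, Submodule.span_le]
  rintro _ ⟨i, rfl⟩
  refine ⟨Pi.single i (Ideal.Quotient.mk b 1), ?_⟩
  simp only [f, LinearMap.sum_apply, LinearMap.comp_apply, LinearMap.proj_apply]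
  rw [Finset.sum_eq_single i]
  · rw [Pi.single_eq_same]
    change (1 : A) • v i = v i
    rw [one_smul]
  · intro j _ hj
    rw [Pi.single_eq_of_ne hj, map_zero]
  · simp

variable [IsNoetherianRing A]

lemma ses_surj {N N' : Type} [AddCommGroup N] [Module A N] [AddCommGroup N'] [Module A N']
    (f : N →ₗ[A] N') (hf : Function.Surjective f) : SES (LinearMap.ker f).subtype f :=
  ⟨Submodule.injective_subtype _, hf, by intro x; simp⟩

lemma finE_devissage {b : Ideal A} {W : Type} [AddCommGroup W] [Module A W] (n : ℕ)
    (h : ∀ i ≤ n, FinE (A := A) i (A ⧸ b) W) : ∀ i ≤ n, ∀ (L : Type) [AddCommGroup L] [Module A L]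
      [Module.Finite A L], Killed b L → FinE (A := A) i L W := by
  intro i
  induction i with
  | zero =>
    intro _ L _ _ _ hL
    obtain ⟨m, f, hf⟩ := exists_surj hL
    exact FinE.of_surj hf ((h 0 (Nat.zero_le n)).pi_left (Fin m))
  | succ i ih =>
    intro hi L _ _ _ hL
    obtain ⟨m, f, hf⟩ := exists_surj hL
    exact (ses_surj f hf).con_right ((h (i+1) hi).pi_left (Fin m))
      (ih (by omega) _ (((killed_quot b).pi _).sub _))

lemma finE_fg (i : ℕ) (L N : Type) [AddCommGroup L] [Module A L] [Module.Finite A L]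
    [AddCommGroup N] [Module A N] [Module.Finite A N] : FinE (A := A) i L N := by
  induction i generalizing L with
  | zero =>
    rw [finE_zero_iff]
    infer_instance
  | succ i ih =>
    obtain ⟨m, f, hf⟩ := Module.Finite.exists_fin' A L
    exact (ses_surj f hf).con_right (FinE.of_free_succ i) (ih _)

lemma fin_comp {E F G : Type*} [AddCommGroup E] [Module A E] [AddCommGroup F] [Module A F]
    [AddCommGroup G] [Module A G] (f : E →ₗ[A] F) (g : F →ₗ[A] G) (hf : (LinearMap.ker f).FG)
    (hg : (LinearMap.ker g).FG) (h : ∀ x, g (f x) = 0) : Module.Finite A E := by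
  refine ⟨Submodule.fg_of_fg_map_of_fg_inf_ker f ?_ (by rwa [top_inf_eq])⟩
  refine Submodule.FG.of_le hg ?_
  rintro _ ⟨x, -, rfl⟩
  exact h x

lemma fg_of_le_range {E F : Type*} [AddCommGroup E] [Module A E] [AddCommGroup F] [Module A F]
    (f : E →ₗ[A] F) (hE : Module.Finite A E) (K : Submodule A F)
    (h : ∀ x ∈ K, ∃ y, f y = x) : K.FG := by
  have hr : Module.Finite A (LinearMap.range f) := Module.Finite.range f
  exact Submodule.FG.of_le (Module.Finite.iff_fg.1 hr) h

/-- multiplication by `x` -/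
abbrev mulBy (x : A) (N : Type) [AddCommGroup N] [Module A N] : N →ₗ[A] N :=
  x • LinearMap.id

lemma finE_of_ker_coker {L N : Type} [AddCommGroup L] [Module A L] [AddCommGroup N] [Module A N]
    (x : A) (hx : ∀ l : L, x • l = 0)
    (h1 : ∀ i, FinE (A := A) i L (LinearMap.ker (mulBy x N)))
    (h2 : ∀ i, FinE (A := A) i L (N ⧸ LinearMap.range (mulBy x N))) (i : ℕ) :
    FinE (A := A) i L N := by
  have s1 := ses_ker (mulBy x N)
  have s2 := ses_mk (LinearMap.range (mulBy x N))
  refine fin_comp (post L (mulBy x N).rangeRestrict i) (post L (Submodule.subtype _) i)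
    ?_ ?_ ?_
  · exact fg_of_le_range _ (h1 i) _ (s1.post_exact i)
  · cases i with
    | zero =>
      rw [LinearMap.ker_eq_bot.2 (post_inj s2.inj)]
      exact Submodule.fg_bot
    | succ i => exact fg_of_le_range _ (h2 i) _ (s2.δ_exact i)
  · intro y
    rw [post_comp]
    have : (Submodule.subtype _) ∘ₗ (mulBy x N).rangeRestrict = mulBy x N := rfl
    rw [this, post_smul, ← pre_smul]
    have h0 : x • (LinearMap.id : L →ₗ[A] L) = (0 : A) • LinearMap.id := by
      ext l; simp [hx]
    rw [h0, pre_smul, zero_smul]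

lemma finE_of_sup {a b : Ideal A} {s : A} (hb : b = a ⊔ Ideal.span {s}) {W : Type} [AddCommGroup W]
    [Module A W] (hs : ∀ w : W, s • w = 0) (h : ∀ i, FinE (A := A) i (A ⧸ b) W) (i : ℕ) :
    ∀ (L : Type) [AddCommGroup L] [Module A L] [Module.Finite A L],
      Killed a L → FinE (A := A) i L W := by
  have key : ∀ (i : ℕ) (L : Type) [AddCommGroup L] [Module A L] [Module.Finite A L], Killed a L →
      (LinearMap.ker (pre W (mulBy s L).rangeRestrict i)).FG → FinE (A := A) i L W := by
    intro i L _ _ _ hL hk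
    have s2 := ses_mk (LinearMap.range (mulBy s L))
    refine fin_comp (pre W (Submodule.subtype _) i) (pre W (mulBy s L).rangeRestrict i)
      ?_ hk ?_
    · refine fg_of_le_range _ ?_ _ (s2.pre_exact i)
      refine finE_devissage (b := b) i (fun j _ => h j) i le_rfl _ ?_
      intro x hx l
      have h1 : Killed (Ideal.span {s}) (L ⧸ LinearMap.range (mulBy s L)) := by
        intro y hy l
        obtain ⟨l, rfl⟩ := Submodule.mkQ_surjective _ l
        obtain ⟨c, rfl⟩ := Ideal.mem_span_singleton'.1 hy
        have hsl : s • l ∈ LinearMap.range (mulBy s L) := ⟨l, rfl⟩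
        rw [mul_smul, ← map_smul, Submodule.mkQ_apply,
          (Submodule.Quotient.mk_eq_zero _).2 hsl, smul_zero]
      rw [hb] at hx
      obtain ⟨y, hy, z, hz, rfl⟩ := Submodule.mem_sup.1 hx
      rw [add_smul, hL.quot _ y hy, h1 z hz, add_zero]
    · intro y
      rw [pre_comp]
      have : (Submodule.subtype _) ∘ₗ (mulBy s L).rangeRestrict = mulBy s L := rfl
      rw [this, pre_smul, ← post_smul]
      have h0 : s • (LinearMap.id : W →ₗ[A] W) = (0 : A) • LinearMap.id := by
        ext l; simp [hs]
      rw [h0, post_smul, zero_smul]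
  induction i with
  | zero =>
    intro L _ _ _ hL
    refine key _ L hL ?_
    rw [LinearMap.ker_eq_bot.2 (pre_inj (LinearMap.surjective_rangeRestrict _))]
    exact Submodule.fg_bot
  | succ i ih =>
    intro L _ _ _ hL
    refine key _ L hL ?_
    refine fg_of_le_range _ ?_ _ ((ses_ker (mulBy s L)).δ'_exact i)
    exact ih _ (hL.sub _)

end KC
end

section
namespace KC
open CategoryTheory.Abelian

section Art
variable {R N : Type} [CommRing R] [AddCommGroup N] [Module R N]

/-- filtration pieces for the dual Hilbert basis argument -/
def cpiece (x : R) (L : Submodule R N) (k : ℕ) : Submodule R N :=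
  (L ⊓ LinearMap.ker (mulBy (x ^ (k+1)) N)).map (mulBy (x ^ k) N)

lemma mem_cpiece {x : R} {L : Submodule R N} {k : ℕ} {n : N} :
    n ∈ cpiece x L k ↔ ∃ m ∈ L, x ^ (k+1) • m = 0 ∧ x ^ k • m = n := by
  simp [cpiece, and_assoc]

lemma cpiece_le (x : R) (L : Submodule R N) (k : ℕ) : cpiece x L k ≤ LinearMap.ker (mulBy x N) := by
  intro n hn
  obtain ⟨m, hm, h0, rfl⟩ := mem_cpiece.1 hn
  simp only [LinearMap.mem_ker, LinearMap.smul_apply, LinearMap.id_apply]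
  rw [smul_smul, ← pow_succ', h0]

lemma cpiece_mono (x : R) {L L' : Submodule R N} (h : L ≤ L') (k : ℕ) :
    cpiece x L k ≤ cpiece x L' k := by
  intro n hn
  obtain ⟨m, hm, h0, rfl⟩ := mem_cpiece.1 hn
  exact mem_cpiece.2 ⟨m, h hm, h0, rfl⟩

lemma cpiece_anti (x : R) (L : Submodule R N) : Antitone (cpiece x L) := by
  refine antitone_nat_of_succ_le fun k => ?_
  intro n hn
  obtain ⟨m, hm, h0, rfl⟩ := mem_cpiece.1 hn
  refine mem_cpiece.2 ⟨x • m, L.smul_mem _ hm, ?_, ?_⟩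
  · rw [smul_smul, ← pow_succ, h0]
  · rw [smul_smul, ← pow_succ]

lemma eq_of_cpiece (x : R) (htor : ∀ n : N, ∃ k : ℕ, x ^ k • n = 0) {L L' : Submodule R N}
    (h : L ≤ L') (hc : ∀ k, cpiece x L' k ≤ cpiece x L k) : L' ≤ L := by
  have key : ∀ k : ℕ, ∀ n ∈ L', x ^ k • n = 0 → n ∈ L := by
    intro k
    induction k with
    | zero =>
      intro n _ hn
      rw [pow_zero, one_smul] at hn
      rw [hn]; exact L.zero_mem
    | succ k ih =>
      intro n hn h0
      obtain ⟨m, hm, h1, h2⟩ := mem_cpiece.1 (hc k (mem_cpiece.2 ⟨n, hn, h0, rfl⟩))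
      have := ih (n - m) (L'.sub_mem hn (h hm)) (by rw [smul_sub, h2, sub_self])
      simpa using L.add_mem this hm
  intro n hn
  obtain ⟨k, hk⟩ := htor n
  exact key k n hn hk

lemma artinian_of_ker (x : R) (htor : ∀ n : N, ∃ k : ℕ, x ^ k • n = 0)
    (hK : IsArtinian R (LinearMap.ker (mulBy x N))) : IsArtinian R N := by
  rw [← monotone_stabilizes_iff_artinian]
  intro f
  set K := LinearMap.ker (mulBy x N)
  have hf : ∀ i j, i ≤ j → OrderDual.ofDual (f j) ≤ OrderDual.ofDual (f i) := fun i j h => f.2 h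
  let g : ℕ → ℕ → Submodule R K := fun i k => (cpiece x (OrderDual.ofDual (f i)) k).comap K.subtype
  have hg : ∀ i i' k k', i ≤ i' → k ≤ k' → g i' k' ≤ g i k := by
    intro i i' k k' h1 h2
    exact Submodule.comap_mono ((cpiece_mono x (hf _ _ h1) k').trans (cpiece_anti x _ h2))
  have hgc : ∀ i i' k, g i k ≤ g i' k → cpiece x (OrderDual.ofDual (f i)) k ≤
      cpiece x (OrderDual.ofDual (f i')) k := by
    intro i i' k h n hn
    exact h (show (⟨n, cpiece_le x _ k hn⟩ : K) ∈ g i k from hn)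
  have stab : ∀ k, ∃ i0, ∀ i ≥ i0, g i k = g i0 k := by
    intro k
    obtain ⟨i0, h⟩ := (monotone_stabilizes_iff_artinian (R := R) (M := K)).2 hK
      ⟨fun i => OrderDual.toDual (g i k), fun i j h => hg i j k k h le_rfl⟩
    exact ⟨i0, fun i hi => (OrderDual.toDual.injective (h i hi)).symm⟩
  obtain ⟨k0, h0⟩ := (monotone_stabilizes_iff_artinian (R := R) (M := K)).2 hK
      ⟨fun i => OrderDual.toDual (g i i), fun i j h => hg i j i j h h⟩
  have h0 : ∀ i ≥ k0, g i i = g k0 k0 := fun i hi => (OrderDual.toDual.injective (h0 i hi)).symm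
  choose I hI using stab
  refine ⟨k0 + ∑ k ∈ Finset.range k0, I k, fun m hm => ?_⟩
  set n := k0 + ∑ k ∈ Finset.range k0, I k
  refine OrderDual.ofDual.injective (le_antisymm ?_ (hf _ _ hm))
  refine eq_of_cpiece x htor (hf _ _ hm) fun k => hgc _ _ _ ?_
  by_cases hk : k < k0
  · have : I k ≤ n := le_trans (Finset.single_le_sum (f := I) (fun _ _ => Nat.zero_le _)
      (Finset.mem_range.2 hk)) (Nat.le_add_left _ _)
    rw [hI k m (this.trans hm), hI k n this]
  · push Not at hk
    have hn : k0 ≤ n := Nat.le_add_right _ _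
    calc g n k ≤ g k0 k0 := hg _ _ _ _ hn hk
      _ = g (max m k) (max m k) := (h0 _ (hk.trans (le_max_right _ _))).symm
      _ ≤ g m k := hg _ _ _ _ (le_max_left _ _) (le_max_right _ _)

lemma artinian_of_list (l : List R) : ∀ (N : Type) [AddCommGroup N] [Module R N],
    (∀ y ∈ l, ∀ n : N, ∃ k : ℕ, y ^ k • n = 0) →
    IsArtinian R (Submodule.torsionBySet R N {y | y ∈ l}) → IsArtinian R N := by
  induction l with
  | nil =>
    intro N _ _ _ h
    have : Submodule.torsionBySet R N {y | y ∈ ([] : List R)} = ⊤ := by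
      ext n; simp [Submodule.mem_torsionBySet_iff]
    rw [this] at h
    exact isArtinian_of_linearEquiv Submodule.topEquiv
  | cons x l ih =>
    intro N _ _ h hA
    refine artinian_of_ker x (h x (by simp)) (ih _ ?_ ?_)
    · intro y hy n
      obtain ⟨k, hk⟩ := h y (by simp [hy]) n.1
      exact ⟨k, Subtype.ext hk⟩
    · let f : Submodule.torsionBySet R (LinearMap.ker (mulBy x N)) {y | y ∈ l} →ₗ[R]
          Submodule.torsionBySet R N {y | y ∈ x :: l} :=
        LinearMap.codRestrict _ ((LinearMap.ker (mulBy x N)).subtype ∘ₗ Submodule.subtype _) (by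
          rintro ⟨⟨n, hn⟩, hn'⟩
          rw [Submodule.mem_torsionBySet_iff] at hn' ⊢
          rintro ⟨y, hy⟩
          rcases List.mem_cons.1 hy with rfl | hy
          · simpa using hn
          · simpa using congrArg Subtype.val (hn' ⟨y, hy⟩))
      refine isArtinian_of_injective f ?_
      intro a b hab
      apply Subtype.ext; apply Subtype.ext
      exact congrArg (fun z => z.1) hab

lemma artinian_of_ideal [IsNoetherianRing R] (a : Ideal R) (N : Type) [AddCommGroup N] [Module R N]
    (h : ∀ y ∈ a, ∀ n : N, ∃ k : ℕ, y ^ k • n = 0)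
    (hA : IsArtinian R (Submodule.torsionBySet R N (a : Set R))) : IsArtinian R N := by
  obtain ⟨s, rfl⟩ := (isNoetherianRing_iff_ideal_fg R).1 inferInstance a
  refine artinian_of_list s.toList N (fun y hy => h y (Ideal.subset_span (by simpa using hy))) ?_
  have : {y | y ∈ s.toList} = (s : Set R) := by ext; simp
  rw [this, Submodule.torsionBySet_eq_torsionBySet_span]
  exact hA

end Art
end KC
end

section
namespace KC
set_option linter.unusedSectionVars false
open CategoryTheory.Abelian
variable [IsNoetherianRing A]

lemma soc_finite {a : Ideal A} {N : Type} [AddCommGroup N] [Module A N]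
    (h : FinE (A := A) 0 (A ⧸ a) N) :
    Module.Finite A (Submodule.torsionBySet A N (a : Set A)) := by
  rw [finE_zero_iff] at h
  let ev : ((A ⧸ a) →ₗ[A] N) →ₗ[A] N := LinearMap.applyₗ (Ideal.Quotient.mk a 1)
  rw [Module.Finite.iff_fg]
  refine fg_of_le_range ev h _ fun n hn => ?_
  rw [Submodule.mem_torsionBySet_iff] at hn
  refine ⟨Submodule.liftQ a (LinearMap.toSpanSingleton A N n) (fun x hx => hn ⟨x, hx⟩), ?_⟩
  change (1 : A) • n = n
  rw [one_smul]

lemma finite_of_killed {a : Ideal A} {N : Type} [AddCommGroup N] [Module A N]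
    (hk : Killed a N) (h : FinE (A := A) 0 (A ⧸ a) N) : Module.Finite A N := by
  have := soc_finite h
  have ht : Submodule.torsionBySet A N (a : Set A) = ⊤ := by
    ext n; simp only [Submodule.mem_torsionBySet_iff, Submodule.mem_top, iff_true]
    exact fun y => hk y y.2 n
  rw [ht] at this
  exact Module.Finite.equiv Submodule.topEquiv

/-- all Ext finite -/
def Cof (a : Ideal A) (N : Type) [AddCommGroup N] [Module A N] : Prop :=
  ∀ i, FinE (A := A) i (A ⧸ a) N

lemma cof_of_killed {a : Ideal A} {N : Type} [AddCommGroup N] [Module A N]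
    (hk : Killed a N) (h : FinE (A := A) 0 (A ⧸ a) N) : Cof a N := by
  have := finite_of_killed hk h
  exact fun i => finE_fg i _ _

lemma killed_sup {c : Ideal A} {x : A} {N : Type} [AddCommGroup N] [Module A N]
    (hc : Killed c N) (hx : ∀ n : N, x • n = 0) : Killed (c ⊔ Ideal.span {x}) N := by
  intro z hz n
  obtain ⟨y, hy, w, hw, rfl⟩ := Submodule.mem_sup.1 hz
  obtain ⟨r, rfl⟩ := Ideal.mem_span_singleton'.1 hw
  rw [add_smul, hc y hy, mul_smul, hx, smul_zero, add_zero]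

/-- predicates closed under subs and quotients -/
structure Clo (A : Type) [CommRing A] (P : ∀ (W : Type) [AddCommGroup W] [Module A W], Prop) :
    Prop where
  sub : ∀ (W : Type) [AddCommGroup W] [Module A W] (K : Submodule A W), P W → P K
  quot : ∀ (W : Type) [AddCommGroup W] [Module A W] (K : Submodule A W), P W → P (W ⧸ K)

lemma inner {P : ∀ (W : Type) [AddCommGroup W] [Module A W], Prop} (hP : Clo A P)
    {a c : Ideal A} {x : A} (n : ℕ) (hn : n ≤ 1)
    (hih : ∀ (W : Type) [AddCommGroup W] [Module A W], Killed (c ⊔ Ideal.span {x}) W → P W →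
      (∀ i ≤ n, FinE (A := A) i (A ⧸ a) W) → Cof a W) (m : ℕ) :
    ∀ (Q : Type) [AddCommGroup Q] [Module A Q], Killed c Q → P Q → (∀ q : Q, x ^ m • q = 0) →
      (∀ i ≤ n, FinE (A := A) i (A ⧸ a) Q) → Cof a Q := by
  induction m with
  | zero =>
    intro Q _ _ _ _ h _
    have : Subsingleton Q := subsingleton_of_forall_eq 0 (fun q => by simpa using h q)
    exact fun i => FinE.of_subsingleton_right i
  | succ m ih =>
    intro Q _ _ hc hQ h hF
    have s1 := ses_ker (mulBy x Q)
    have h1 : Cof a (LinearMap.ker (mulBy x Q)) := by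
      refine hih _ (killed_sup (hc.sub _) ?_) (hP.sub _ _ hQ) ?_
      · rintro ⟨q, hq⟩
        exact Subtype.ext (by simpa using hq)
      · intro i hi
        match i with
        | 0 => exact FinE.of_inj s1.inj (hF 0 hi)
        | 1 => exact s1.cov_left (hF 1 hi)
                (FinE.of_inj (Submodule.injective_subtype _) (hF 0 (by omega)))
        | i+2 => omega
    have h2 : Cof a (LinearMap.range (mulBy x Q)) := by
      refine ih _ (hc.sub _) (hP.sub _ _ hQ) ?_ (fun i hi => s1.cov_right (hF i hi) (h1 _))
      rintro ⟨_, q, rfl⟩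
      apply Subtype.ext
      have := h q
      rw [pow_succ, mul_smul] at this
      simpa using this
    exact fun i => s1.cov_mid (h1 i) (h2 i)

lemma clo_art : Clo A (fun W _ _ => IsArtinian A W) :=
  ⟨fun _ _ _ _ _ => inferInstance, fun _ _ _ _ _ => inferInstance⟩

lemma sup_cons (c : Ideal A) (x : A) (l : List A) :
    (c ⊔ Ideal.span {x}) ⊔ Ideal.span {y | y ∈ l} = c ⊔ Ideal.span {y | y ∈ x :: l} := by
  have : {y | y ∈ x :: l} = {x} ∪ {y | y ∈ l} := by ext; simp
  rw [this, Ideal.span_union, sup_assoc]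

lemma c0_list {a : Ideal A} (l : List A) : ∀ (c : Ideal A) (Q : Type) [AddCommGroup Q] [Module A Q],
    Killed c Q → c ⊔ Ideal.span {y | y ∈ l} = a → IsArtinian A Q →
      FinE (A := A) 0 (A ⧸ a) Q → Cof a Q := by
  induction l with
  | nil =>
    intro c Q _ _ hc ha _ h
    have : c = a := by rw [← ha]; simp
    subst this
    exact cof_of_killed hc h
  | cons x l ih =>
    intro c Q _ _ hc ha hart h
    have hih : ∀ (W : Type) [AddCommGroup W] [Module A W], Killed (c ⊔ Ideal.span {x}) W →
      IsArtinian A W → (∀ i ≤ 0, FinE (A := A) i (A ⧸ a) W) → Cof a W := by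
      intro W _ _ h1 h2 h3
      exact ih _ W h1 (by rw [sup_cons, ha]) h2 (h3 0 le_rfl)
    have hxa : x ∈ a := by
      rw [← ha]; exact Ideal.mem_sup_right (Ideal.subset_span (by simp))
    obtain ⟨m, hm⟩ := (monotone_stabilizes_iff_artinian (R := A) (M := Q)).2 hart
      ⟨fun i => OrderDual.toDual (LinearMap.range (mulBy (x ^ i) Q)), by
        refine monotone_nat_of_le_succ fun i => ?_
        rintro _ ⟨q, rfl⟩
        exact ⟨x • q, by simp [smul_smul, pow_succ, mul_comm]⟩⟩
    have hm : LinearMap.range (mulBy (x ^ m) Q) = LinearMap.range (mulBy (x ^ (m+1)) Q) :=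
      OrderDual.toDual.injective (hm (m+1) (by omega))
    set D := LinearMap.range (mulBy (x ^ m) Q) with hD
    have hD0 : FinE (A := A) 0 (A ⧸ a) D := FinE.of_inj D.injective_subtype h
    have cD : Cof a D := by
      refine fun i => finE_of_ker_coker x (killed_quot a x hxa) ?_ ?_ i
      · refine hih _ (killed_sup ((hc.sub _).sub _) ?_) inferInstance ?_
        · rintro ⟨q, hq⟩
          exact Subtype.ext (by simpa using hq)
        · intro i hi
          obtain rfl : i = 0 := by omega
          exact FinE.of_inj (Submodule.injective_subtype _) hD0
      · have : LinearMap.range (mulBy x D) = ⊤ := by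
          rw [LinearMap.range_eq_top]
          rintro ⟨d, hd⟩
          have hd' := hd
          rw [hm] at hd'
          obtain ⟨q, hq⟩ := hd'
          refine ⟨⟨x ^ m • q, ⟨q, rfl⟩⟩, Subtype.ext ?_⟩
          refine Eq.trans ?_ hq
          simp [smul_smul, pow_succ']
        have : Subsingleton (D ⧸ LinearMap.range (mulBy x D)) :=
          Submodule.Quotient.subsingleton_iff.2 this
        exact fun i => FinE.of_subsingleton_right i
    have cQ : Cof a (Q ⧸ D) := by
      refine inner clo_art 0 (by omega) hih m _ (hc.quot _) inferInstance ?_ ?_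
      · intro q
        obtain ⟨q, rfl⟩ := D.mkQ_surjective q
        rw [← map_smul, Submodule.mkQ_apply, Submodule.Quotient.mk_eq_zero]
        exact ⟨q, rfl⟩
      · intro i hi
        obtain rfl : i = 0 := by omega
        exact (ses_mk D).cov_right h (cD 1)
    exact fun i => (ses_mk D).cov_mid (cD i) (cQ i)

lemma exists_list (a : Ideal A) : ∃ l : List A, (⊥ : Ideal A) ⊔ Ideal.span {y | y ∈ l} = a := by
  obtain ⟨s, rfl⟩ := (isNoetherianRing_iff_ideal_fg A).1 inferInstance a
  refine ⟨s.toList, ?_⟩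
  have : {y | y ∈ s.toList} = (s : Set A) := by ext; simp
  rw [this, bot_sup_eq]

lemma killed_bot (N : Type) [AddCommGroup N] [Module A N] : Killed (⊥ : Ideal A) N := by
  intro x hx n
  rw [Ideal.mem_bot.1 hx, zero_smul]

lemma cof_of_artinian (a : Ideal A) (Q : Type) [AddCommGroup Q] [Module A Q] [h : IsArtinian A Q]
    (h0 : FinE (A := A) 0 (A ⧸ a) Q) : Cof a Q := by
  obtain ⟨l, hl⟩ := exists_list a
  exact c0_list l ⊥ Q (killed_bot Q) hl h h0

/-- torsion modules -/
def Tors (a : Ideal A) (N : Type) [AddCommGroup N] [Module A N] : Prop :=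
  ∀ y ∈ a, ∀ n : N, ∃ k : ℕ, y ^ k • n = 0

lemma Tors.sub {a : Ideal A} {N : Type} [AddCommGroup N] [Module A N] (h : Tors a N)
    (K : Submodule A N) : Tors a K := by
  intro y hy n
  obtain ⟨k, hk⟩ := h y hy n.1
  exact ⟨k, Subtype.ext hk⟩

lemma Tors.quot {a : Ideal A} {N : Type} [AddCommGroup N] [Module A N] (h : Tors a N)
    (K : Submodule A N) : Tors a (N ⧸ K) := by
  intro y hy n
  obtain ⟨n, rfl⟩ := K.mkQ_surjective n
  obtain ⟨k, hk⟩ := h y hy n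
  exact ⟨k, by rw [← map_smul, hk, map_zero]⟩

lemma clo_tors (a : Ideal A) : Clo A (fun W _ _ => Tors a W) :=
  ⟨fun _ _ _ K h => h.sub K, fun _ _ _ K h => h.quot K⟩

end KC
end

section
namespace KC
set_option linter.unusedSectionVars false
open CategoryTheory.Abelian

/-- `ch d p`: there is a chain of primes of length `d` starting at `p` -/
def ch : ℕ → Ideal A → Prop
  | 0, p => p.IsPrime
  | d+1, p => p.IsPrime ∧ ∃ q, p < q ∧ ch d q

lemma ch.isPrime {d : ℕ} {p : Ideal A} (h : ch d p) : p.IsPrime := by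
  cases d with
  | zero => exact h
  | succ d => exact h.1

def DimLE (d : ℕ) (a : Ideal A) : Prop := ∀ p, a ≤ p → ¬ ch (d+1) p

lemma artinian_fg {R : Type} [CommRing R] [IsNoetherianRing R] (b : Ideal R)
    (hb : ∀ p : Ideal R, p.IsPrime → b ≤ p → p.IsMaximal) (W : Type) [AddCommGroup W] [Module R W]
    [Module.Finite R W] (hW : Killed b W) : IsArtinian R W := by
  obtain ⟨m, f, hf⟩ := exists_surj hW
  have h1 : IsArtinianRing (R ⧸ b) := by
    rw [isArtinianRing_iff_krullDimLE_zero,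
      Ideal.krullDimLE_zero_quotient_iff_forall_minimalPrimes_isMaximal]
    exact fun J hJ => hb J hJ.1.1 hJ.1.2
  have h2 : IsArtinian R (R ⧸ b) := by
    let e : (R ⧸ b) →ₛₗ[Ideal.Quotient.mk b] (R ⧸ b) :=
      { toFun := id, map_add' := fun _ _ => rfl, map_smul' := fun _ _ => rfl }
    have : RingHomSurjective (Ideal.Quotient.mk b) := ⟨Ideal.Quotient.mk_surjective⟩
    exact (e.isArtinian_iff_of_bijective Function.bijective_id).2 h1
  exact isArtinian_of_surjective _ f hf

/-- the multiplicative set avoiding the nonmaximal primes over `a` -/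
def msub (a : Ideal A) : Submonoid A where
  carrier := {s | ∀ p : Ideal A, p.IsPrime → a ≤ p → ¬ p.IsMaximal → s ∉ p}
  one_mem' := fun _ hp _ _ h => hp.ne_top ((Ideal.eq_top_iff_one _).2 h)
  mul_mem' := fun {_ _} hs ht p hp h1 h2 h3 =>
    (hp.mem_or_mem h3).elim (hs p hp h1 h2) (ht p hp h1 h2)

lemma exists_lt_of_not_max {p : Ideal A} (hp : p.IsPrime) (h : ¬ p.IsMaximal) :
    ∃ q : Ideal A, p < q ∧ q.IsPrime := by
  obtain ⟨q, hq, hpq⟩ := Ideal.exists_le_maximal p hp.ne_top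
  refine ⟨q, lt_of_le_of_ne hpq ?_, hq.isPrime⟩
  rintro rfl; exact h hq

variable [IsNoetherianRing A]

lemma msub_meets {a : Ideal A} (ha : DimLE 1 a) {m : Ideal A} (hm : m.IsMaximal) :
    ∃ s ∈ msub a, s ∈ m := by
  by_contra! hcon
  let T : Set (Ideal A) := {p | p.IsPrime ∧ a ≤ p ∧ ¬ p.IsMaximal}
  have hT : T.Finite := by
    refine (Ideal.finite_minimalPrimes_of_isNoetherianRing A a).subset ?_
    rintro p ⟨h1, h2, h3⟩
    refine ⟨⟨h1, h2⟩, ?_⟩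
    rintro q ⟨hq, haq⟩ hqp
    by_contra hne
    obtain ⟨r, hr, hr'⟩ := exists_lt_of_not_max h1 h3
    exact ha q haq ⟨hq, p, lt_of_le_not_ge hqp hne, h1, r, hr, hr'⟩
  have : (m : Set A) ⊆ ⋃ i ∈ T, (id i : Ideal A) := by
    intro s hs
    by_contra hs'
    refine hcon s ?_ hs
    intro p h1 h2 h3 h4
    refine hs' ?_
    simp only [Set.mem_iUnion]
    exact ⟨p, ⟨h1, h2, h3⟩, h4⟩
  obtain ⟨p, hp, hmp⟩ := (Ideal.subset_union_prime_finite hT ⊥ ⊥ (fun i hi _ _ => hi.1)).1 this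
  have := hm.eq_of_le hp.1.ne_top hmp
  exact hp.2.2 (this ▸ hm)

lemma max_loc {a : Ideal A} (ha : DimLE 1 a) (P : Ideal (Localization (msub a))) (hP : P.IsPrime)
    (h : a.map (algebraMap A (Localization (msub a))) ≤ P) : P.IsMaximal := by
  obtain ⟨Q, hQ, hPQ⟩ := Ideal.exists_le_maximal P hP.ne_top
  rcases eq_or_lt_of_le hPQ with rfl | hlt
  · exact hQ
  exfalso
  have h1 := (IsLocalization.isPrime_iff_isPrime_disjoint (msub a) _ P).1 hP
  have h2 := (IsLocalization.isPrime_iff_isPrime_disjoint (msub a) _ Q).1 hQ.isPrime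
  have hlt' : P.under A < Q.under A := by
    refine lt_of_le_of_ne (Ideal.comap_mono hPQ) fun he => hlt.ne ?_
    rw [← IsLocalization.map_under (msub a) _ P, he, IsLocalization.map_under (msub a) _ Q]
  have hnm : ¬ (Q.under A).IsMaximal := by
    intro hm
    obtain ⟨s, hs, hs'⟩ := msub_meets ha hm
    exact Set.disjoint_left.1 h2.2 hs hs'
  obtain ⟨r, hr, hr'⟩ := exists_lt_of_not_max h2.1 hnm
  exact ha _ (Ideal.map_le_iff_le_comap.1 h) ⟨h1.1, _, hlt', h2.1, r, hr, hr'⟩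

lemma max_sup {a : Ideal A} {s : A} (hs : s ∈ msub a) (p : Ideal A) (hp : p.IsPrime)
    (h : a ⊔ Ideal.span {s} ≤ p) : p.IsMaximal := by
  by_contra hm
  exact hs p hp (le_sup_left.trans h) hm (h (Ideal.mem_sup_right (Ideal.mem_span_singleton_self s)))

lemma artinian_loc {a : Ideal A} (ha : DimLE 1 a) (N : Type) [AddCommGroup N] [Module A N]
    (ht : Tors a N) (h0 : FinE (A := A) 0 (A ⧸ a) N) :
    IsArtinian (Localization (msub a)) (LocalizedModule (msub a) N) := by
  set S := msub a
  set R := Localization S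
  set b := a.map (algebraMap A R)
  have hnoeth : IsNoetherianRing R := IsLocalization.isNoetherianRing S R inferInstance
  refine artinian_of_ideal b _ ?_ ?_
  · intro y hy n
    obtain ⟨⟨⟨y', hy'⟩, t⟩, hyt⟩ := (IsLocalization.mem_map_algebraMap_iff S R).1 hy
    obtain ⟨n, u, rfl⟩ : ∃ n' u, n = LocalizedModule.mk n' u := by
      induction n using LocalizedModule.induction_on with
      | h n' u => exact ⟨n', u, rfl⟩
    obtain ⟨k, hk⟩ := ht y' hy' n
    refine ⟨k, ?_⟩
    have hu : IsUnit (algebraMap A R t) := IsLocalization.map_units R t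
    have h1 : (y * algebraMap A R t) ^ k • LocalizedModule.mk n u = 0 := by
      dsimp only at hyt
      rw [hyt, ← map_pow, algebraMap_smul, LocalizedModule.smul'_mk, hk, LocalizedModule.zero_mk]
    rw [mul_pow, mul_comm, mul_smul] at h1
    exact (hu.pow k).smul_eq_zero.1 h1
  · have hfin : Module.Finite R (Submodule.torsionBySet R (LocalizedModule S N) (b : Set R)) := by
      have hs := soc_finite h0
      rw [Module.Finite.iff_fg] at hs ⊢
      obtain ⟨g, hg⟩ := hs
      classical
      refine ⟨g.image (fun n => LocalizedModule.mk n 1), ?_⟩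
      have hb : ∀ n ∈ Submodule.torsionBySet A N (a : Set A), LocalizedModule.mk n 1 ∈
          Submodule.torsionBySet R (LocalizedModule S N) (b : Set R) := by
        intro n hn
        rw [Submodule.mem_torsionBySet_iff] at hn ⊢
        have : b ≤ LinearMap.ker (LinearMap.toSpanSingleton R _ (LocalizedModule.mk n (1 : S))) := by
          rw [Ideal.map_le_iff_le_comap]
          intro y hy
          simp only [Ideal.mem_comap, LinearMap.mem_ker, LinearMap.toSpanSingleton_apply]
          rw [algebraMap_smul, LocalizedModule.smul'_mk, hn ⟨y, hy⟩, LocalizedModule.zero_mk]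
        exact fun y => this y.2
      apply le_antisymm
      · rw [Submodule.span_le]
        intro z hz
        simp only [Finset.coe_image, Set.mem_image, Finset.mem_coe] at hz
        obtain ⟨n, hn, rfl⟩ := hz
        exact hb n (hg ▸ Submodule.subset_span hn)
      · have hspan : ∀ n ∈ Submodule.torsionBySet A N (a : Set A), LocalizedModule.mk n (1 : S) ∈
          Submodule.span R (g.image (fun n => LocalizedModule.mk n (1 : S)) : Set _) := by
          intro n hn
          have hle : Submodule.span A (g : Set N) ≤
              ((Submodule.span R (g.image (fun n => LocalizedModule.mk n (1 : S)) :
              Set (LocalizedModule S N))).restrictScalars A).comap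
                (LocalizedModule.mkLinearMap S N) := by
            rw [Submodule.span_le]
            intro n hn
            exact Submodule.subset_span (by simpa using ⟨n, hn, rfl⟩)
          rw [← hg] at hn
          exact hle hn
        intro z hz
        obtain ⟨n, u, rfl⟩ : ∃ n' u, z = LocalizedModule.mk n' u := by
          induction z using LocalizedModule.induction_on with
          | h n' u => exact ⟨n', u, rfl⟩
        rw [Submodule.mem_torsionBySet_iff] at hz
        have hex : ∀ y ∈ a, ∃ t : S, t.1 • y • n = 0 := by
          intro y hy
          have := hz ⟨algebraMap A R y, Ideal.mem_map_of_mem _ hy⟩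
          simp only at this
          rw [algebraMap_smul, LocalizedModule.smul'_mk, ← LocalizedModule.zero_mk u,
            LocalizedModule.mk_eq] at this
          obtain ⟨t, ht⟩ := this
          refine ⟨t * u, ?_⟩
          simp only [smul_zero, Submonoid.smul_def] at ht
          rw [Submonoid.coe_mul, mul_smul, ht]
        have hex2 : ∃ t : S, ∀ y ∈ a, t.1 • y • n = 0 := by
          obtain ⟨l, hl⟩ := (isNoetherianRing_iff_ideal_fg A).1 inferInstance a
          have hl2 : ∀ y ∈ l, ∃ t : S, t.1 • y • n = 0 := fun y hy =>
            hex y (hl ▸ Ideal.subset_span hy)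
          choose! t ht using hl2
          refine ⟨∏ y ∈ l, t y, fun y hy => ?_⟩
          have hle : a ≤ LinearMap.ker (LinearMap.toSpanSingleton A N ((∏ y ∈ l, t y : S).1 • n)) := by
            rw [← hl, Ideal.span_le]
            intro y hy
            simp only [SetLike.mem_coe, LinearMap.mem_ker, LinearMap.toSpanSingleton_apply]
            rw [← Finset.prod_erase_mul l t hy, smul_smul, Submonoid.coe_mul, mul_comm, mul_assoc,
              mul_smul, mul_smul, ht y hy, smul_zero]
          have := hle hy
          simp only [LinearMap.mem_ker, LinearMap.toSpanSingleton_apply] at this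
          rw [smul_comm]; exact this
        obtain ⟨t, ht⟩ := hex2
        have : LocalizedModule.mk n u = Localization.mk 1 (t * u) • LocalizedModule.mk (t.1 • n) (1 : S) := by
          rw [LocalizedModule.mk_smul_mk, one_smul, mul_one]
          exact (LocalizedModule.mk_cancel_common_left t u n).symm
        rw [this]
        refine Submodule.smul_mem _ _ (hspan _ ?_)
        rw [Submodule.mem_torsionBySet_iff]
        intro y
        rw [smul_comm]; exact ht y y.2
    refine artinian_fg b (max_loc ha) _ ?_
    intro y hy n
    have := (Submodule.mem_torsionBySet_iff (b : Set R) n.1).1 n.2 ⟨y, hy⟩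
    exact Subtype.ext this

end KC
end

section
namespace KC
set_option linter.unusedSectionVars false
open CategoryTheory.Abelian
variable [IsNoetherianRing A]

lemma exists_stab {a : Ideal A} (ha : DimLE 1 a) (x : A) (N : Type) [AddCommGroup N] [Module A N]
    (ht : Tors a N) (h0 : FinE (A := A) 0 (A ⧸ a) N) :
    ∃ m : ℕ, ∀ n : N, ∃ s ∈ msub a, ∃ n' : N, s • x ^ m • n = x ^ (m+1) • n' := by
  have hart := artinian_loc ha N ht h0
  let f : ℕ → Submodule (Localization (msub a)) (LocalizedModule (msub a) N) := fun i =>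
    LinearMap.range (mulBy ((algebraMap A (Localization (msub a)) x) ^ i)
      (LocalizedModule (msub a) N))
  obtain ⟨m, hm⟩ := (monotone_stabilizes_iff_artinian).2 hart
      ⟨fun i => OrderDual.toDual (f i), by
        refine monotone_nat_of_le_succ fun i => ?_
        rintro _ ⟨q, rfl⟩
        exact ⟨(algebraMap A (Localization (msub a)) x) • q, by
          rw [pow_succ]
          exact (mul_smul ((algebraMap A (Localization (msub a)) x) ^ i)
            (algebraMap A (Localization (msub a)) x) q).symm⟩⟩
  have hm : f m = f (m+1) := OrderDual.toDual.injective (hm (m+1) (by omega))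
  refine ⟨m, fun n => ?_⟩
  have h1 : (algebraMap A (Localization (msub a)) x) ^ m • LocalizedModule.mk n 1 ∈ f m := ⟨_, rfl⟩
  rw [hm] at h1
  obtain ⟨z, hz⟩ := h1
  obtain ⟨n', u, rfl⟩ : ∃ n' u, z = LocalizedModule.mk n' u := by
    induction z using LocalizedModule.induction_on with
    | h n' u => exact ⟨n', u, rfl⟩
  simp only [LinearMap.smul_apply, LinearMap.id_apply] at hz
  rw [← map_pow, ← map_pow, algebraMap_smul, algebraMap_smul, LocalizedModule.smul'_mk,
    LocalizedModule.smul'_mk, LocalizedModule.mk_eq] at hz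
  obtain ⟨t, ht⟩ := hz
  simp only [Submonoid.smul_def, one_smul] at ht
  refine ⟨t * u, (msub a).mul_mem t.2 u.2, t.1 • n', ?_⟩
  rw [mul_smul, ← ht, smul_comm]

lemma artinian_of_msub {a : Ideal A} (N : Type) [AddCommGroup N] [Module A N]
    (ht : Tors a N) (h0 : FinE (A := A) 0 (A ⧸ a) N) (h : ∀ n : N, ∃ s ∈ msub a, s • n = 0) :
    IsArtinian A N := by
  refine artinian_of_ideal a N ht ?_
  have hf := soc_finite h0
  obtain ⟨g, hg⟩ := Module.finite_def.1 hf
  choose s hs hs' using h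
  set T := ∏ n ∈ g, s n.1
  have hT : T ∈ msub a := Submonoid.prod_mem _ fun n _ => hs n
  refine artinian_fg (a ⊔ Ideal.span {T}) (max_sup hT) _ (killed_sup ?_ ?_)
  · intro y hy n
    have := (Submodule.mem_torsionBySet_iff (a : Set A) n.1).1 n.2 ⟨y, hy⟩
    exact Subtype.ext this
  · intro n
    have hle : Submodule.span A (g : Set (Submodule.torsionBySet A N (a : Set A))) ≤
        LinearMap.ker (mulBy T _) := by
      rw [Submodule.span_le]
      intro n hn
      apply Subtype.ext
      classical
      simp only [LinearMap.smul_apply, LinearMap.id_apply, T]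
      rw [← Finset.prod_erase_mul g _ hn, mul_smul]
      have : s n.1 • n = 0 := Subtype.ext (hs' n.1)
      rw [this, smul_zero]
    rw [hg] at hle
    exact hle (Submodule.mem_top (x := n))

lemma ker_smul {x : A} {N : Type} [AddCommGroup N] [Module A N] (q : LinearMap.ker (mulBy x N)) :
    x • q = 0 := Subtype.ext q.2

lemma s1_list {a : Ideal A} (hd : DimLE 1 a) (l : List A) :
    ∀ (c : Ideal A) (N : Type) [AddCommGroup N] [Module A N],
    Killed c N → c ⊔ Ideal.span {y | y ∈ l} = a → Tors a N →
      (∀ i ≤ 1, FinE (A := A) i (A ⧸ a) N) → Cof a N := by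
  induction l with
  | nil =>
    intro c Q _ _ hc ha _ h
    have : c = a := by rw [← ha]; simp
    subst this
    exact cof_of_killed hc (h 0 (by omega))
  | cons x l ih =>
    intro c N _ _ hc ha htor h
    have hih : ∀ (W : Type) [AddCommGroup W] [Module A W], Killed (c ⊔ Ideal.span {x}) W →
      Tors a W → (∀ i ≤ 1, FinE (A := A) i (A ⧸ a) W) → Cof a W := by
      intro W _ _ h1 h2 h3
      exact ih _ W h1 (by rw [sup_cons, ha]) h2 h3
    have hxa : x ∈ a := by
      rw [← ha]; exact Ideal.mem_sup_right (Ideal.subset_span (by simp))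
    have hle1 : ∀ (W : Type) [AddCommGroup W] [Module A W] (y : A),
        (∀ i ≤ 1, FinE (A := A) i (A ⧸ a) W) →
        ∀ i ≤ 1, FinE (A := A) i (A ⧸ a) (LinearMap.ker (mulBy y W)) := by
      intro W _ _ y hW i hi
      have s1 := ses_ker (mulBy y W)
      match i with
      | 0 => exact FinE.of_inj s1.inj (hW 0 hi)
      | 1 => exact s1.cov_left (hW 1 hi)
              (FinE.of_inj (Submodule.injective_subtype _) (hW 0 (by omega)))
      | i+2 => omega
    obtain ⟨m, hm⟩ := exists_stab hd x N htor (h 0 (by omega))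
    have sN := ses_ker (mulBy (x ^ m) N)
    have cK : Cof a (LinearMap.ker (mulBy (x ^ m) N)) :=
      inner (clo_tors a) 1 le_rfl hih m _ (hc.sub _) (htor.sub _) ker_smul (hle1 _ _ h)
    set D := LinearMap.range (mulBy (x ^ m) N) with hD
    have tD : Tors a D := htor.sub _
    have hD01 : ∀ i ≤ 1, FinE (A := A) i (A ⧸ a) D := fun i hi => sN.cov_right (h i hi) (cK _)
    have sD := ses_ker (mulBy x D)
    have cD' : Cof a (LinearMap.ker (mulBy x D)) :=
      hih _ (killed_sup ((hc.sub _).sub _) ker_smul) (tD.sub _) (hle1 _ _ hD01)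
    have h1 : FinE (A := A) 1 (A ⧸ a) (LinearMap.range (mulBy x D)) :=
      sD.cov_right (hD01 1 le_rfl) (cD' 2)
    have h0 : FinE (A := A) 0 (A ⧸ a) (D ⧸ LinearMap.range (mulBy x D)) :=
      (ses_mk _).cov_right (hD01 0 (by omega)) h1
    have : IsArtinian A (D ⧸ LinearMap.range (mulBy x D)) := by
      refine artinian_of_msub (a := a) _ (tD.quot _) h0 ?_
      intro d
      obtain ⟨⟨d, n, rfl⟩, rfl⟩ := Submodule.mkQ_surjective _ d
      obtain ⟨s, hs, n', hn⟩ := hm n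
      refine ⟨s, hs, ?_⟩
      rw [← map_smul, Submodule.mkQ_apply, Submodule.Quotient.mk_eq_zero]
      refine ⟨⟨x ^ m • n', n', rfl⟩, Subtype.ext ?_⟩
      have : x • x ^ m • n' = s • x ^ m • n := by
        rw [hn, pow_succ', mul_smul]
      simpa using this
    have cD'' := cof_of_artinian a _ h0
    have cD : Cof a D := finE_of_ker_coker x (killed_quot a x hxa) cD' cD''
    exact fun i => sN.cov_mid (cK i) (cD i)

/-- the statement S_n for the ideal a -/
def SN (n : ℕ) (a : Ideal A) : Prop := ∀ (N : Type) [AddCommGroup N] [Module A N], Tors a N →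
  (∀ i ≤ n, FinE (A := A) i (A ⧸ a) N) → Cof a N

lemma s1 {a : Ideal A} (hd : DimLE 1 a) : SN 1 a := by
  intro N _ _ ht h
  obtain ⟨l, hl⟩ := exists_list a
  exact s1_list hd l ⊥ N (killed_bot N) hl ht h

/-- Reduction lemma -/
lemma red {a b : Ideal A} {s : A} (hb : b = a ⊔ Ideal.span {s}) (n : ℕ) (hS : SN n b) (k : ℕ) :
    ∀ (W : Type) [AddCommGroup W] [Module A W], Tors a W →
      (∀ y ∈ a ^ k, ∀ w : W, (s * y) • w = 0) → (∀ i ≤ n, FinE (A := A) i (A ⧸ a) W) → Cof a W := by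
  induction k with
  | zero =>
    intro W _ _ ht h hF
    have hs : ∀ w : W, s • w = 0 := fun w => by simpa using h 1 (by simp) w
    have cb : Cof b W := by
      refine hS W ?_ ?_
      · intro y hy w
        rw [hb] at hy
        obtain ⟨u, hu, v, hv, rfl⟩ := Submodule.mem_sup.1 hy
        obtain ⟨r, rfl⟩ := Ideal.mem_span_singleton'.1 hv
        obtain ⟨j, hj⟩ := ht u hu w
        refine ⟨j, ?_⟩
        obtain ⟨q, hq⟩ : ∃ q, (u + r * s) ^ j = u ^ j + q * s := by
          have : Ideal.Quotient.mk (Ideal.span {s}) ((u + r * s) ^ j) =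
              Ideal.Quotient.mk (Ideal.span {s}) (u ^ j) := by
            rw [map_pow, map_pow]
            congr 1
            rw [Ideal.Quotient.eq]
            exact Ideal.mem_span_singleton'.2 ⟨r, by ring⟩
          rw [Ideal.Quotient.eq] at this
          obtain ⟨q, hq⟩ := Ideal.mem_span_singleton'.1 this
          exact ⟨q, by rw [hq]; ring⟩
        rw [hq, add_smul, hj, mul_smul, hs, smul_zero, add_zero]
      · intro i hi
        exact finE_devissage n hF i hi _ ((killed_quot b).mono (hb ▸ le_sup_left))
    exact fun i => finE_of_sup hb hs cb i _ (killed_quot a)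
  | succ k ih =>
    intro W _ _ ht h hF
    set F := Submodule.torsionBySet A W (a : Set A)
    have hFf : Module.Finite A F := soc_finite (hF 0 (Nat.zero_le _))
    have cF : Cof a F := fun i => finE_fg i _ _
    have cQ : Cof a (W ⧸ F) := by
      refine ih _ (ht.quot _) ?_ (fun i hi => (ses_mk F).cov_right (hF i hi) (cF _))
      intro y hy w
      obtain ⟨w, rfl⟩ := F.mkQ_surjective w
      rw [← map_smul, Submodule.mkQ_apply, Submodule.Quotient.mk_eq_zero,
        Submodule.mem_torsionBySet_iff]
      rintro ⟨z, hz⟩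
      have := h (y * z) (by rw [pow_succ]; exact Ideal.mul_mem_mul hy hz) w
      change z • (s * y) • w = 0
      rw [smul_smul, ← this]
      congr 1; ring
    exact fun i => (ses_mk F).cov_mid (cF i) (cQ i)

end KC
end

section
namespace KC
set_option linter.unusedSectionVars false
open CategoryTheory.Abelian

lemma ch_coheight {d : ℕ} : ∀ {p : Ideal A} (h : ch d p),
    (d : ℕ∞) ≤ Order.coheight (⟨p, h.isPrime⟩ : PrimeSpectrum A) := by
  induction d with
  | zero => intro p h; simp
  | succ d ih =>
    intro p h
    obtain ⟨hp, q, hpq, hq⟩ := h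
    have h1 := ih hq
    have h2 : Order.coheight (⟨q, hq.isPrime⟩ : PrimeSpectrum A) + 1 ≤
      Order.coheight (⟨p, hp⟩ : PrimeSpectrum A) := Order.coheight_add_one_le hpq
    refine le_trans ?_ h2
    push_cast
    gcongr

lemma no_ch (h : ringKrullDim A ≤ 3) (p : Ideal A) : ¬ ch 4 p := by
  intro hp
  have h1 := ch_coheight hp
  have h2 := Order.coheight_le_krullDim (⟨p, hp.isPrime⟩ : PrimeSpectrum A)
  have h3 : ((4 : ℕ∞) : WithBot ℕ∞) ≤ 3 := by
    refine le_trans ?_ (h2.trans h)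
    exact_mod_cast h1
  exact absurd h3 (by decide)

variable [IsNoetherianRing A]

lemma exists_s (a : Ideal A) (x : A) (d : ℕ)
    (hP : ∀ p ∈ a.minimalPrimes, ch d p → p ∈ (Ideal.span {x}).minimalPrimes) :
    ∃ (s : A) (k : ℕ), (∀ y ∈ a ^ k, s * y ∈ Ideal.span {x}) ∧
      ∀ p ∈ a.minimalPrimes, ch d p → s ∉ p := by
  set I := Ideal.span {x}
  obtain ⟨k, hk⟩ := Ideal.exists_radical_pow_le_of_fg I (IsNoetherian.noetherian _)
  let J : Ideal A := I.colon (a ^ k : Ideal A)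
  have hfin := Ideal.finite_minimalPrimes_of_isNoetherianRing A I
  have key : ∀ p ∈ a.minimalPrimes, ch d p → ¬ J ≤ p := by
    intro p hpa hpc hJ
    have hp := hP p hpa hpc
    have hpp := hpa.1.1
    have hfin' : (I.minimalPrimes \ {p}).Finite := hfin.subset Set.sdiff_subset
    have : ¬ (hfin'.toFinset.inf id ≤ p) := by
      intro hle
      obtain ⟨q, hq, hqp⟩ := (Ideal.IsPrime.inf_le' hpp).1 hle
      have hq' := hfin'.mem_toFinset.1 hq
      refine hq'.2 (le_antisymm hqp (hp.2 hq'.1.1 hqp))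
    obtain ⟨c, hc, hcp⟩ := SetLike.not_le_iff_exists.1 this
    have hca : Ideal.span {c} * a ≤ I.radical := by
      rw [← Ideal.sInf_minimalPrimes]
      refine le_sInf fun q hq => ?_
      by_cases hqp : q = p
      · subst hqp
        exact Ideal.mul_le_right.trans hpa.1.2
      · refine Ideal.mul_le_left.trans ?_
        rw [Ideal.span_singleton_le_iff_mem]
        exact (Finset.inf_le (f := id) (hfin'.mem_toFinset.2 ⟨hq, hqp⟩)) hc
    have hcJ : c ^ k ∈ J := by
      rw [Submodule.mem_colon]
      intro y hy
      refine hk ((Ideal.pow_right_mono hca k) ?_)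
      rw [mul_pow, Ideal.span_singleton_pow]
      exact Ideal.mul_mem_mul (Ideal.mem_span_singleton_self _) hy
    exact hcp (hpp.mem_of_pow_mem _ (hJ hcJ))
  have hT : {p | p ∈ a.minimalPrimes ∧ ch d p}.Finite :=
    (Ideal.finite_minimalPrimes_of_isNoetherianRing A a).subset fun p hp => hp.1
  have hnot : ¬ ((J : Set A) ⊆ ⋃ i ∈ {p | p ∈ a.minimalPrimes ∧ ch d p}, (id i : Ideal A)) := by
    intro hsub
    obtain ⟨p, hp, hle⟩ := (Ideal.subset_union_prime_finite hT ⊥ ⊥ (fun i hi _ _ => hi.1.1.1)).1 hsub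
    exact key p hp.1 hp.2 hle
  obtain ⟨s, hs, hs'⟩ := Set.not_subset.1 hnot
  refine ⟨s, k, fun y hy => Submodule.mem_colon.1 hs y hy, fun p h1 h2 h3 => hs' ?_⟩
  simp only [Set.mem_iUnion]
  exact ⟨p, ⟨h1, h2⟩, h3⟩

lemma dim_drop {a : Ideal A} {d : ℕ} (ha : DimLE (d+1) a) {s : A}
    (hs : ∀ p ∈ a.minimalPrimes, ch (d+1) p → s ∉ p) : DimLE d (a ⊔ Ideal.span {s}) := by
  intro q hq hc
  have hqp := hc.isPrime
  obtain ⟨p, hp, hpq⟩ := Ideal.exists_minimalPrimes_le (I := a) (J := q) (le_sup_left.trans hq)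
  rcases eq_or_lt_of_le hpq with rfl | hlt
  · exact hs p hp hc (hq (Ideal.mem_sup_right (Ideal.mem_span_singleton_self s)))
  · exact ha p hp.1.2 ⟨hp.1.1, q, hlt, hc⟩

lemma exists_x (h4 : ∀ p : Ideal A, ¬ ch 4 p) (a : Ideal A) : ∃ x ∈ a, ∀ p ∈ a.minimalPrimes,
    ch 2 p → p ∈ (Ideal.span {x}).minimalPrimes := by
  let T : Set (Ideal A) := {q | q ∈ minimalPrimes A ∧ ¬ a ≤ q}
  have hT : T.Finite := (Ideal.finite_minimalPrimes_of_isNoetherianRing A ⊥).subset fun p hp => hp.1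
  have hnot : ¬ ((a : Set A) ⊆ ⋃ i ∈ T, (id i : Ideal A)) := by
    intro hsub
    obtain ⟨p, hp, hle⟩ := (Ideal.subset_union_prime_finite hT ⊥ ⊥ (fun i hi _ _ => hi.1.1.1)).1 hsub
    exact hp.2 hle
  obtain ⟨x, hx, hx'⟩ := Set.not_subset.1 hnot
  refine ⟨x, hx, fun p hp hc => ⟨⟨hp.1.1, ?_⟩, ?_⟩⟩
  · rw [Ideal.span_singleton_le_iff_mem]
    exact hp.1.2 hx
  · rintro q ⟨hq, hxq⟩ hqp
    rw [Ideal.span_singleton_le_iff_mem] at hxq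
    by_contra hne
    have hqp' : q < p := lt_of_le_not_ge hqp hne
    have hqm : q ∈ minimalPrimes A := by
      refine ⟨⟨hq, bot_le⟩, ?_⟩
      rintro r ⟨hr, -⟩ hrq
      by_contra hne
      exact h4 r ⟨hr, q, lt_of_le_not_ge hrq hne, hq, p, hqp', hc⟩
    have haq : a ≤ q := by
      by_contra haq
      refine hx' ?_
      simp only [Set.mem_iUnion]
      exact ⟨q, ⟨hqm, haq⟩, hxq⟩
    exact hne (hp.2 ⟨hq, haq⟩ hqp)

lemma s2 (h4 : ∀ p : Ideal A, ¬ ch 4 p) {a : Ideal A} (ha : DimLE 2 a) : SN 2 a := by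
  intro N _ _ ht hF
  obtain ⟨x, hxa, hx⟩ := exists_x h4 a
  obtain ⟨s, k, hsk, hs⟩ := exists_s a x 2 hx
  have hS := s1 (dim_drop ha hs)
  have sN := ses_ker (mulBy x N)
  have kill : ∀ (W : Type) [AddCommGroup W] [Module A W], (∀ w : W, x • w = 0) →
      (∀ y ∈ a ^ k, ∀ w : W, (s * y) • w = 0) := by
    intro W _ _ hW y hy w
    obtain ⟨r, hr⟩ := Ideal.mem_span_singleton'.1 (hsk y hy)
    rw [← hr, mul_smul, hW, smul_zero]
  have c1 : Cof a (LinearMap.ker (mulBy x N)) := by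
    refine red rfl 1 hS k _ (ht.sub _) (kill _ ker_smul) ?_
    intro i hi
    match i with
    | 0 => exact FinE.of_inj sN.inj (hF 0 (by omega))
    | 1 => exact sN.cov_left (hF 1 (by omega))
            (FinE.of_inj (Submodule.injective_subtype _) (hF 0 (by omega)))
    | i+2 => omega
  have hR : ∀ i ≤ 2, FinE (A := A) i (A ⧸ a) (LinearMap.range (mulBy x N)) :=
    fun i hi => sN.cov_right (hF i hi) (c1 _)
  have c2 : Cof a (N ⧸ LinearMap.range (mulBy x N)) := by
    refine red rfl 1 hS k _ (ht.quot _) (kill _ ?_) ?_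
    · intro w
      obtain ⟨w, rfl⟩ := Submodule.mkQ_surjective _ w
      rw [← map_smul, Submodule.mkQ_apply, Submodule.Quotient.mk_eq_zero]
      exact ⟨w, rfl⟩
    · intro i hi
      exact (ses_mk _).cov_right (hF i (by omega)) (hR (i+1) (by omega))
  exact finE_of_ker_coker x (killed_quot a x hxa) c1 c2

lemma s3 (h4 : ∀ p : Ideal A, ¬ ch 4 p) (a : Ideal A) : SN 2 a := by
  intro N _ _ ht hF
  obtain ⟨s, k, hsk, hs⟩ := exists_s a 0 3 (by
    intro p hp hc
    refine ⟨⟨hp.1.1, by simp⟩, ?_⟩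
    rintro q ⟨hq, -⟩ hqp
    by_contra hne
    exact h4 q ⟨hq, p, lt_of_le_not_ge hqp hne, hc⟩)
  have hS := s2 h4 (dim_drop (d := 2) (fun p _ => h4 p) hs)
  refine red rfl 2 hS k N ht ?_ hF
  intro y hy w
  have := hsk y hy
  rw [Ideal.mem_span_singleton, zero_dvd_iff] at this
  rw [this, zero_smul]

end KC
end

section
namespace KC
set_option linter.unusedSectionVars false
open CategoryTheory.Abelian

section K
variable {t : ℕ} (x : Fin t → A) (M : Type) [AddCommGroup M] [Module A M]

/-- extension by zero of a Koszul cochain -/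
def extz {i : ℕ} (f : KoszulCochain x M i) (u : Finset (Fin t)) : M :=
  if h : u.card = i then f ⟨u, h⟩ else 0

/-- the sign -/
def sgn (u : Finset (Fin t)) (j : Fin t) : A := (-1) ^ ((u.filter (fun k => k < j)).card)

lemma koszulD_apply (i : ℕ) (f : KoszulCochain x M i) (s : {s : Finset (Fin t) // s.card = i+1}) :
    koszulD x M i f s = ∑ j ∈ s.1, (sgn s.1 j * x j) • extz x M f (s.1.erase j) := by
  rw [← Finset.sum_attach s.1]
  simp only [koszulD, LinearMap.pi_apply, LinearMap.sum_apply, LinearMap.smul_apply,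
    LinearMap.proj_apply]
  refine Finset.sum_congr rfl fun j _ => ?_
  rw [extz, dif_pos]
  rfl

lemma extz_koszulD (i : ℕ) (f : KoszulCochain x M i) (u : Finset (Fin t)) (hu : u.card = i+1) :
    extz x M (koszulD x M i f) u = ∑ j ∈ u, (sgn u j * x j) • extz x M f (u.erase j) := by
  rw [extz, dif_pos hu, koszulD_apply]

lemma sgn_lt {s : Finset (Fin t)} {j k : Fin t} (hj : j ∈ s) (hjk : j < k) :
    (sgn s j * sgn (s.erase j) k : A) = - (sgn s k * sgn (s.erase k) j) := by
  have h1 : (s.erase k).filter (fun l => l < j) = s.filter (fun l => l < j) := by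
    ext l
    simp only [Finset.mem_filter, Finset.mem_erase]
    constructor
    · rintro ⟨⟨_, h⟩, h'⟩; exact ⟨h, h'⟩
    · rintro ⟨h, h'⟩; exact ⟨⟨(h'.trans hjk).ne, h⟩, h'⟩
  have h2 : s.filter (fun l => l < k) = insert j ((s.erase j).filter (fun l => l < k)) := by
    ext l
    simp only [Finset.mem_filter, Finset.mem_erase, Finset.mem_insert]
    constructor
    · rintro ⟨h, h'⟩
      by_cases hl : l = j
      · exact Or.inl hl
      · exact Or.inr ⟨⟨hl, h⟩, h'⟩
    · rintro (rfl | ⟨⟨_, h⟩, h'⟩)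
      · exact ⟨hj, hjk⟩
      · exact ⟨h, h'⟩
  have h3 : (s.filter (fun l => l < k)).card = ((s.erase j).filter (fun l => l < k)).card + 1 := by
    rw [h2, Finset.card_insert_of_notMem (by simp)]
  unfold sgn
  rw [h1, h3, pow_succ]
  ring

lemma sgn_ne {s : Finset (Fin t)} {j k : Fin t} (hj : j ∈ s) (hk : k ∈ s) (hjk : j ≠ k) :
    (sgn s j * sgn (s.erase j) k : A) = - (sgn s k * sgn (s.erase k) j) := by
  rcases lt_or_gt_of_ne hjk with h | h
  · exact sgn_lt hj h
  · rw [sgn_lt hk h, neg_neg]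

lemma koszulD_comp (i : ℕ) (f : KoszulCochain x M i) : koszulD x M (i+1) (koszulD x M i f) = 0 := by
  ext s
  rw [koszulD_apply, Pi.zero_apply]
  have h1 : ∀ j ∈ s.1, (sgn s.1 j * x j) • extz x M (koszulD x M i f) (s.1.erase j) =
      ∑ k ∈ s.1.erase j, (sgn s.1 j * x j) • (sgn (s.1.erase j) k * x k) •
        extz x M f ((s.1.erase j).erase k) := by
    intro j hj
    rw [extz_koszulD _ _ _ _ _ (by rw [Finset.card_erase_of_mem hj, s.2]; rfl), Finset.smul_sum]
  rw [Finset.sum_congr rfl h1, Finset.sum_sigma']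
  refine Finset.sum_involution (fun p _ => ⟨p.2, p.1⟩) ?_ ?_ ?_ ?_
  · rintro ⟨j, k⟩ h
    simp only [Finset.mem_sigma, Finset.mem_erase] at h
    obtain ⟨hj, hkj, hk⟩ := h
    simp only [smul_smul]
    rw [Finset.erase_right_comm (a := k) (b := j), ← add_smul]
    have := sgn_ne (A := A) hj hk hkj.symm
    have e : sgn s.1 j * x j * (sgn (s.1.erase j) k * x k) +
      sgn s.1 k * x k * (sgn (s.1.erase k) j * x j) = 0 := by
      linear_combination (x j * x k) * this
    rw [e, zero_smul]
  · rintro ⟨j, k⟩ h _ he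
    simp only [Finset.mem_sigma, Finset.mem_erase] at h
    have : k = j := congrArg Sigma.fst he
    exact h.2.1 this
  · rintro ⟨j, k⟩ h
    simp only [Finset.mem_sigma, Finset.mem_erase] at h ⊢
    exact ⟨h.2.2, h.2.1.symm, h.1⟩
  · rintro ⟨j, k⟩ _; rfl

lemma boundary_le (i : ℕ) : koszulBoundary x M i ≤ LinearMap.ker (koszulD x M i) := by
  cases i with
  | zero => exact bot_le
  | succ i =>
    rintro _ ⟨f, rfl⟩
    exact koszulD_comp x M i f

end K

lemma ses_hom {C C' : Type} [AddCommGroup C] [Module A C] [AddCommGroup C'] [Module A C']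
    (d : C →ₗ[A] C') (B : Submodule A C) (hB : B ≤ LinearMap.ker d) :
    SES (Submodule.mapQ (B.comap (LinearMap.ker d).subtype) B (LinearMap.ker d).subtype le_rfl)
      (B.liftQ d.rangeRestrict (by rwa [LinearMap.ker_rangeRestrict])) := by
  refine ⟨?_, ?_, ?_⟩
  · rw [← LinearMap.ker_eq_bot, Submodule.ker_mapQ, Submodule.mkQ_map_self]
  · intro y
    obtain ⟨c, rfl⟩ := d.surjective_rangeRestrict y
    exact ⟨B.mkQ c, rfl⟩
  · intro y
    obtain ⟨c, rfl⟩ := B.mkQ_surjective y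
    constructor
    · intro h
      exact ⟨Submodule.mkQ _ ⟨c, congrArg Subtype.val h⟩, rfl⟩
    · rintro ⟨z, hz⟩
      obtain ⟨z, rfl⟩ := Submodule.mkQ_surjective _ z
      rw [← hz]
      exact Subtype.ext z.2

lemma tors_of_support {a : Ideal A} {N : Type} [AddCommGroup N] [Module A N]
    (h : Module.support A N ⊆ PrimeSpectrum.zeroLocus (a : Set A)) : Tors a N := by
  intro y hy n
  have : y ∈ (Submodule.span A {n}).annihilator.radical := by
    rw [Ideal.radical_eq_sInf, Ideal.mem_sInf]
    rintro p ⟨hp1, hp2⟩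
    exact h (a := ⟨p, hp2⟩) (Module.mem_support_iff_exists_annihilator.2 ⟨n, hp1⟩) hy
  obtain ⟨k, hk⟩ := this
  exact ⟨k, (Submodule.mem_annihilator_span_singleton n _).1 hk⟩

lemma support_of_tors {a : Ideal A} {N : Type} [AddCommGroup N] [Module A N]
    (h : Tors a N) : Module.support A N ⊆ PrimeSpectrum.zeroLocus (a : Set A) := by
  intro p hp y hy
  obtain ⟨n, hn⟩ := Module.mem_support_iff_exists_annihilator.1 hp
  obtain ⟨k, hk⟩ := h y hy n
  exact p.2.mem_of_pow_mem k (hn ((Submodule.mem_annihilator_span_singleton n _).2 hk))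

lemma tors_pi {a : Ideal A} {N : Type} [AddCommGroup N] [Module A N] (h : Tors a N)
    (ι : Type) [Finite ι] : Tors a (ι → N) := by
  intro y hy n
  choose k hk using fun i => h y hy (n i)
  classical
  have := Fintype.ofFinite ι
  refine ⟨∑ i, k i, ?_⟩
  ext i
  rw [Pi.smul_apply, ← Finset.add_sum_erase _ _ (Finset.mem_univ i), add_comm, pow_add, mul_smul,
    hk, smul_zero, Pi.zero_apply]

variable [IsNoetherianRing A]

lemma cof_iff (a : Ideal A) (N : Type) [AddCommGroup N] [Module A N] :
    IsCofinite a N ↔ Tors a N ∧ Cof a N :=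
  ⟨fun h => ⟨tors_of_support h.1, fun i => (finE_iff a N i).1 (h.2 i)⟩,
    fun h => ⟨support_of_tors h.1, fun i => (finE_iff a N i).2 (h.2 i)⟩⟩

section Main
variable (a : Ideal A) {t : ℕ} (x : Fin t → A) (M : Type) [AddCommGroup M] [Module A M]

lemma tors_H (hM : Tors a M) (i : ℕ) : Tors a (KoszulCohomology x M i) :=
  ((tors_pi hM _).sub _).quot _

lemma cof_C (hM : Cof a M) (i : ℕ) : Cof a (KoszulCochain x M i) :=
  fun j => (hM j).pi_right _

lemma cof_zero (hM : Cof a M) : Cof a (KoszulCochain x M 0 ⧸ koszulBoundary x M 0) :=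
  fun j => (cof_C a x M hM 0 j).congr_right (Submodule.quotEquivOfEqBot _ rfl).symm

lemma cof_step (hM : Cof a M) (i : ℕ) (hP : Cof a (KoszulCochain x M i ⧸ koszulBoundary x M i))
    (hH : Cof a (KoszulCohomology x M i)) :
    Cof a (KoszulCochain x M (i+1) ⧸ koszulBoundary x M (i+1)) := by
  have h1 : Cof a (LinearMap.range (koszulD x M i)) := fun j =>
    (ses_hom _ _ (boundary_le x M i)).cov_right (hP j) (hH (j+1))
  exact fun j => (ses_mk (koszulBoundary x M (i+1))).cov_right (cof_C a x M hM (i+1) j) (h1 (j+1))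

lemma cof_H (hS : SN 2 a) (ht : Tors a M) (hM : Cof a M) (i : ℕ)
    (hP : Cof a (KoszulCochain x M i ⧸ koszulBoundary x M i))
    (h0 : FinE (A := A) 0 (A ⧸ a) (KoszulCohomology x M i))
    (h1 : FinE (A := A) 0 (A ⧸ a) (KoszulCohomology x M (i+1))) :
    Cof a (KoszulCohomology x M i) := by
  have b0 : ∀ j, FinE (A := A) 0 (A ⧸ a) (LinearMap.range (koszulD x M j)) := fun j =>
    FinE.of_inj (Submodule.injective_subtype _) (cof_C a x M hM (j+1) 0)
  have p0 : FinE (A := A) 0 (A ⧸ a) (KoszulCochain x M (i+1) ⧸ koszulBoundary x M (i+1)) :=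
    (ses_hom _ _ (boundary_le x M (i+1))).cov_mid h1 (b0 (i+1))
  have b1 : FinE (A := A) 1 (A ⧸ a) (LinearMap.range (koszulD x M i)) :=
    (ses_mk (koszulBoundary x M (i+1))).cov_left (cof_C a x M hM (i+1) 1) p0
  have s := ses_hom _ _ (boundary_le x M i)
  refine hS _ (tors_H a x M ht i) fun j hj => ?_
  match j with
  | 0 => exact h0
  | 1 => exact s.cov_left (hP 1) (b0 i)
  | 2 => exact s.cov_left (hP 2) b1
  | j+3 => omega

end Main
end KC
end

theorem stmt16 [IsNoetherianRing A] (hdimA : ringKrullDim A ≤ 3) (𝔞 : Ideal A)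
    {t : ℕ} (x : Fin t → A)
    (M : Type) [AddCommGroup M] [Module A M] (hM : IsCofinite 𝔞 M) (n : ℕ) :
    (∀ i ≤ n + 1, Module.Finite A ((A ⧸ 𝔞) →ₗ[A] KoszulCohomology x M i)) ↔
      (∀ i ≤ n, IsCofinite 𝔞 (KoszulCohomology x M i)) := by
  obtain ⟨ht, hc⟩ := (KC.cof_iff 𝔞 M).1 hM
  have hS := KC.s3 (KC.no_ch hdimA) 𝔞
  have hP : (∀ i ≤ n, KC.Cof 𝔞 (KoszulCochain x M i ⧸ koszulBoundary x M i) →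
      KC.Cof 𝔞 (KoszulCohomology x M i)) →
      ∀ i ≤ n + 1, KC.Cof 𝔞 (KoszulCochain x M i ⧸ koszulBoundary x M i) := by
    intro h i
    induction i with
    | zero => intro _; exact KC.cof_zero 𝔞 x M hc
    | succ i ih =>
      intro hi
      have h1 := ih (by omega)
      exact KC.cof_step 𝔞 x M hc i h1 (h i (by omega) h1)
  constructor
  · intro h i hi
    have hH : ∀ i ≤ n, KC.Cof 𝔞 (KoszulCochain x M i ⧸ koszulBoundary x M i) →
      KC.Cof 𝔞 (KoszulCohomology x M i) := fun i hi hPi =>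
        KC.cof_H 𝔞 x M hS ht hc i hPi (KC.finE_zero_iff.2 (h i (by omega)))
          (KC.finE_zero_iff.2 (h (i+1) (by omega)))
    exact (KC.cof_iff 𝔞 _).2 ⟨KC.tors_H 𝔞 x M ht i, hH i hi (hP hH i (by omega))⟩
  · intro h i hi
    have hPi := hP (fun i hi _ => ((KC.cof_iff 𝔞 _).1 (h i hi)).2) i hi
    exact KC.finE_zero_iff.1
      (KC.FinE.of_inj (KC.ses_hom _ _ (KC.boundary_le x M i)).inj (hPi 0))

end
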